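/- arXiv:1707.00476 — 5 statements merged into one kernel-verified Lean document; each statement's English description precedes it below -/
import Mathlib

section
/- Let S ⊆ ℝ^d be bounded, measurable, and of positive volume, and let λ > 0. Then α_S(λ) ≥ λ · exp(−λ · E[vol(T(v,X))]), where the expectation is over the two-part experiment in which a configuration X is drawn from the hard sphere model on S at fugacity λ and, independently, v is a uniform point of S, and T(v,X) is the externally uncovered region. -/
open MeasureTheory Filter

/-- `rd d` is the radius of a Euclidean ball of volume 1 in `ℝ^d`. -/
noncomputable def rd (d : ℕ) : ℝ :=
  ((volume (Metric.closedBall (0 : EuclideanSpace ℝ (Fin d)) 1)).toReal) ^ (-(1 : ℝ) / d)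

/-- The set of `k`-tuples of points of `S` with pairwise distances `> 2 r_d`,
i.e. centers of packings by balls of volume 1. -/
def packSet (d k : ℕ) (S : Set (EuclideanSpace ℝ (Fin d))) :
    Set (Fin k → EuclideanSpace ℝ (Fin d)) :=
  {x | (∀ i, x i ∈ S) ∧ ∀ i j, i ≠ j → dist (x i) (x j) > 2 * rd d}

/-- The canonical hard sphere partition function `Ẑ_S(k)`. -/
noncomputable def Zhat (d : ℕ) (S : Set (EuclideanSpace ℝ (Fin d))) (k : ℕ) : ℝ :=
  (1 / (Nat.factorial k : ℝ)) *
    ∫ x : Fin k → EuclideanSpace ℝ (Fin d),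
      Set.indicator (packSet d k S) (fun _ => (1 : ℝ)) x

/-- The grand canonical hard sphere partition function `Z_S(λ)`. -/
noncomputable def Zgc (d : ℕ) (S : Set (EuclideanSpace ℝ (Fin d))) (lam : ℝ) : ℝ :=
  ∑' k : ℕ, lam ^ k * Zhat d S k

/-- The expected packing density `α_S(λ)` of the hard sphere model. -/
noncomputable def alphaS (d : ℕ) (S : Set (EuclideanSpace ℝ (Fin d))) (lam : ℝ) : ℝ :=
  (∑' k : ℕ, (k : ℝ) * lam ^ k * Zhat d S k) / ((volume S).toReal * Zgc d S lam)

/-- `Bn d n` is the closed ball of volume `n` centered at the origin in `ℝ^d`. -/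
noncomputable def Bn (d : ℕ) (n : ℝ) : Set (EuclideanSpace ℝ (Fin d)) :=
  Metric.closedBall 0 (n ^ ((1 : ℝ) / d) * rd d)

/-- The maximum number of centers of a packing of `B_n` by balls of volume 1. -/
noncomputable def Md (d : ℕ) (n : ℝ) : ℝ :=
  sSup {m : ℝ | ∃ X : Finset (EuclideanSpace ℝ (Fin d)),
    (∀ x ∈ X, x ∈ Bn d n) ∧ (∀ x ∈ X, ∀ y ∈ X, x ≠ y → dist x y > 2 * rd d) ∧
    m = (X.card : ℝ)}

/-- The externally uncovered region `T(v,X)` for a configuration `X = (x_1,…,x_k)`. -/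
def Treg (d : ℕ) (S : Set (EuclideanSpace ℝ (Fin d))) (v : EuclideanSpace ℝ (Fin d))
    {k : ℕ} (x : Fin k → EuclideanSpace ℝ (Fin d)) : Set (EuclideanSpace ℝ (Fin d)) :=
  {p | p ∈ Metric.closedBall v (2 * rd d) ∩ S ∧
    ∀ i, dist (x i) v > 2 * rd d → dist p (x i) > 2 * rd d}

/-- The expectation of a functional `g(v, X)` under the two-part experiment:
`X` drawn from the hard sphere model on `S` at fugacity `λ`, and independently
`v` uniform in `S`. -/
noncomputable def ExpT (d : ℕ) (S : Set (EuclideanSpace ℝ (Fin d))) (lam : ℝ)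
    (g : EuclideanSpace ℝ (Fin d) → ∀ k : ℕ, (Fin k → EuclideanSpace ℝ (Fin d)) → ℝ) : ℝ :=
  (1 / ((volume S).toReal * Zgc d S lam)) *
    ∑' k : ℕ, (lam ^ k / (Nat.factorial k : ℝ)) *
      ∫ v in S, ∫ x : Fin k → EuclideanSpace ℝ (Fin d),
        Set.indicator (packSet d k S) (fun y => g v k y) x

open scoped ENNReal

section aux

/-- packings indexed by a general type. -/
def auxP (d : ℕ) (ι : Type) (S : Set (EuclideanSpace ℝ (Fin d))) :
    Set (ι → EuclideanSpace ℝ (Fin d)) :=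
  {x | (∀ i, x i ∈ S) ∧ ∀ i j, i ≠ j → dist (x i) (x j) > 2 * rd d}

/-- packings avoiding the ball around `v`. -/
def auxQ (d : ℕ) (ι : Type) (S : Set (EuclideanSpace ℝ (Fin d)))
    (v : EuclideanSpace ℝ (Fin d)) : Set (ι → EuclideanSpace ℝ (Fin d)) :=
  {x | x ∈ auxP d ι S ∧ ∀ i, dist (x i) v > 2 * rd d}

/-- uncovered region for general index type. -/
def auxT (d : ℕ) (ι : Type) (S : Set (EuclideanSpace ℝ (Fin d)))
    (v : EuclideanSpace ℝ (Fin d)) (x : ι → EuclideanSpace ℝ (Fin d)) :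
    Set (EuclideanSpace ℝ (Fin d)) :=
  {p | p ∈ Metric.closedBall v (2 * rd d) ∩ S ∧
    ∀ i, dist (x i) v > 2 * rd d → dist p (x i) > 2 * rd d}

lemma auxP_meas {d : ℕ} (ι : Type) [Fintype ι] {S : Set (EuclideanSpace ℝ (Fin d))}
    (hM : MeasurableSet S) : MeasurableSet (auxP d ι S) := by
  unfold auxP
  refine MeasurableSet.inter (s₁ := {x : ι → EuclideanSpace ℝ (Fin d) | ∀ i, x i ∈ S})
    (s₂ := {x | ∀ i j, i ≠ j → dist (x i) (x j) > 2 * rd d}) ?_ ?_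
  · rw [Set.ofPred_forall]
    exact MeasurableSet.iInter fun i => measurable_pi_apply i hM
  · simp only [Set.ofPred_forall]
    refine MeasurableSet.iInter fun i => MeasurableSet.iInter fun j => MeasurableSet.iInter fun _ => ?_
    exact measurableSet_lt measurable_const ((measurable_pi_apply i).dist (measurable_pi_apply j))

lemma auxQ_meas {d : ℕ} (ι : Type) [Fintype ι] {S : Set (EuclideanSpace ℝ (Fin d))}
    (hM : MeasurableSet S) :
    MeasurableSet {p : EuclideanSpace ℝ (Fin d) × (ι → EuclideanSpace ℝ (Fin d)) |
      p.2 ∈ auxQ d ι S p.1} := by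
  unfold auxQ
  refine MeasurableSet.inter (s₁ := {p : EuclideanSpace ℝ (Fin d) × (ι → EuclideanSpace ℝ (Fin d)) | p.2 ∈ auxP d ι S})
    (s₂ := {p | ∀ i, dist (p.2 i) p.1 > 2 * rd d}) (measurable_snd (auxP_meas ι hM)) ?_
  simp only [Set.ofPred_forall]
  refine MeasurableSet.iInter fun i => ?_
  exact measurableSet_lt measurable_const
    (((measurable_pi_apply i).comp measurable_snd).dist measurable_fst)

lemma auxT_meas {d : ℕ} (ι : Type) [Fintype ι] {S : Set (EuclideanSpace ℝ (Fin d))}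
    (hM : MeasurableSet S) :
    MeasurableSet {p : (EuclideanSpace ℝ (Fin d) × (ι → EuclideanSpace ℝ (Fin d))) ×
      EuclideanSpace ℝ (Fin d) | p.2 ∈ auxT d ι S p.1.1 p.1.2} := by
  have h1 : MeasurableSet {p : (EuclideanSpace ℝ (Fin d) × (ι → EuclideanSpace ℝ (Fin d))) ×
      EuclideanSpace ℝ (Fin d) | dist p.2 p.1.1 ≤ 2 * rd d} :=
    measurableSet_le (measurable_snd.dist (measurable_fst.comp measurable_fst)) measurable_const
  have h2 : MeasurableSet {p : (EuclideanSpace ℝ (Fin d) × (ι → EuclideanSpace ℝ (Fin d))) ×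
      EuclideanSpace ℝ (Fin d) | p.2 ∈ S} := measurable_snd hM
  have h3 : MeasurableSet {p : (EuclideanSpace ℝ (Fin d) × (ι → EuclideanSpace ℝ (Fin d))) ×
      EuclideanSpace ℝ (Fin d) | ∀ i, dist (p.1.2 i) p.1.1 > 2 * rd d → dist p.2 (p.1.2 i) > 2 * rd d} := by
    rw [Set.ofPred_forall]
    refine MeasurableSet.iInter fun i => ?_
    have e : Measurable fun p : (EuclideanSpace ℝ (Fin d) × (ι → EuclideanSpace ℝ (Fin d))) ×
      EuclideanSpace ℝ (Fin d) => p.1.2 i :=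
      (measurable_pi_apply i).comp (measurable_snd.comp measurable_fst)
    have a := measurableSet_lt (measurable_const (a := 2 * rd d))
      (e.dist (measurable_fst.comp measurable_fst))
    have b := measurableSet_lt (measurable_const (a := 2 * rd d)) (measurable_snd.dist e)
    exact a.imp b
  exact (h1.inter h2).inter h3

lemma auxT_vol_meas {d : ℕ} (ι : Type) [Fintype ι] {S : Set (EuclideanSpace ℝ (Fin d))}
    (hM : MeasurableSet S) :
    Measurable fun p : EuclideanSpace ℝ (Fin d) × (ι → EuclideanSpace ℝ (Fin d)) =>
      volume (auxT d ι S p.1 p.2) :=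
  measurable_measure_prodMk_left (auxT_meas ι hM)

lemma aux_reindex {d : ℕ} {ι κ : Type} [Fintype ι] [Fintype κ] (e : ι ≃ κ)
    (S : Set (EuclideanSpace ℝ (Fin d))) (v : EuclideanSpace ℝ (Fin d)) (H : ℝ≥0∞ → ℝ≥0∞) :
    ∫⁻ z, (auxQ d ι S v).indicator (fun z => H (volume (auxT d ι S v z))) z =
    ∫⁻ z, (auxQ d κ S v).indicator (fun z => H (volume (auxT d κ S v z))) z := by
  rw [← (volume_measurePreserving_piCongrLeft (fun _ : κ => EuclideanSpace ℝ (Fin d)) e).lintegral_comp_emb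
    (MeasurableEquiv.measurableEmbedding _)]
  congr 1
  ext z
  have hz : ∀ i, (MeasurableEquiv.piCongrLeft (fun _ : κ => EuclideanSpace ℝ (Fin d)) e z) (e i) = z i :=
    fun i => Equiv.piCongrLeft_apply_apply (fun _ : κ => EuclideanSpace ℝ (Fin d)) e z i
  generalize (MeasurableEquiv.piCongrLeft (fun _ : κ => EuclideanSpace ℝ (Fin d)) e z) = w at hz
  obtain rfl : z = w ∘ e := by ext1 i; exact (hz i).symm
  have h1 : auxT d ι S v (w ∘ e) = auxT d κ S v w := by
    ext p
    simp only [auxT, Set.mem_ofPred_eq, Function.comp]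
    rw [← e.forall_congr_right (q := fun i => dist (w i) v > 2 * rd d → dist p (w i) > 2 * rd d)]
  have h2 : w ∘ e ∈ auxQ d ι S v ↔ w ∈ auxQ d κ S v := by
    simp only [auxQ, auxP, Set.mem_ofPred_eq, Function.comp]
    rw [← e.forall_congr_right (q := fun i => dist (w i) v > 2 * rd d),
      ← e.forall_congr_right (q := fun i => w i ∈ S),
      ← e.forall_congr_right (q := fun i => ∀ j, i ≠ j → dist (w i) (w j) > 2 * rd d)]
    refine and_congr (and_congr_right fun _ => forall_congr' fun i => ?_) Iff.rfl
    rw [← e.forall_congr_right (q := fun j => e i ≠ j → dist (w (e i)) (w j) > 2 * rd d)]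
    simp
  classical
  rw [Set.indicator_apply, Set.indicator_apply, h1]
  simp only [h2]

lemma aux_piece {d k : ℕ} (S : Set (EuclideanSpace ℝ (Fin d))) (v : EuclideanSpace ℝ (Fin d))
    (F : ℝ≥0∞ → ℝ≥0∞) (A : Finset (Fin k)) :
    ∫⁻ x : Fin k → EuclideanSpace ℝ (Fin d),
      ({x | x ∈ auxP d (Fin k) S ∧ ∀ i, i ∈ A ↔ dist (x i) v ≤ 2 * rd d}).indicator
        (fun x => F (volume (auxT d (Fin k) S v x))) x ≤
    ∫⁻ z, (auxQ d (Fin (k - A.card)) S v).indicator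
      (fun z => volume (auxT d _ S v z) ^ A.card * F (volume (auxT d _ S v z))) z := by
  classical
  have e : {i // i ∉ A} ≃ Fin (k - A.card) := Fintype.equivFinOfCardEq (by simp)
  rw [← aux_reindex e S v (fun t => t ^ A.card * F t)]
  let G : ({i // i ∉ A} → EuclideanSpace ℝ (Fin d)) × ({i // ¬ i ∉ A} → EuclideanSpace ℝ (Fin d)) → ℝ≥0∞ :=
    fun p => (auxQ d {i // i ∉ A} S v).indicator (fun z =>
      (Set.univ.pi fun _ : {i // ¬ i ∉ A} => auxT d {i // i ∉ A} S v z).indicator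
        (fun _ => F (volume (auxT d _ S v z))) p.2) p.1
  calc _ ≤ ∫⁻ x, G (MeasurableEquiv.piEquivPiSubtypeProd (fun _ : Fin k => EuclideanSpace ℝ (Fin d))
            (fun i => i ∉ A) x) := by
        refine lintegral_mono fun x => ?_
        by_cases hx : x ∈ {x | x ∈ auxP d (Fin k) S ∧ ∀ i, i ∈ A ↔ dist (x i) v ≤ 2 * rd d}
        swap
        · simp [Set.indicator_of_notMem hx]
        rw [Set.indicator_of_mem hx]
        obtain ⟨⟨hS, hd⟩, hA⟩ := hx
        have hA' : ∀ i, i ∉ A ↔ dist (x i) v > 2 * rd d := fun i => by rw [hA i, not_le]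
        have hTT : auxT d {i // i ∉ A} S v (fun i => x i) = auxT d (Fin k) S v x := by
          ext p
          simp only [auxT, Set.mem_ofPred_eq]
          refine and_congr_right fun _ => ⟨fun h i hi => h ⟨i, (hA' i).2 hi⟩ hi, fun h i hi => h i hi⟩
        show _ ≤ (auxQ d {i // i ∉ A} S v).indicator (fun z =>
          (Set.univ.pi fun _ : {i // ¬ i ∉ A} => auxT d {i // i ∉ A} S v z).indicator
            (fun _ => F (volume (auxT d _ S v z))) (fun i => x i)) (fun i => x i)
        rw [Set.indicator_of_mem, Set.indicator_of_mem, hTT]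
        · intro i _
          refine ⟨⟨(hA i).1 (not_not.1 i.2), hS i⟩, fun j _ => hd i j ?_⟩
          intro h
          exact i.2 (h ▸ j.2)
        · exact ⟨⟨fun i => hS i, fun i j hij => hd i j fun h => hij (Subtype.ext h)⟩,
            fun i => (hA' i).1 i.2⟩
    _ = ∫⁻ p, G p := (volume_preserving_piEquivPiSubtypeProd (fun _ : Fin k => EuclideanSpace ℝ (Fin d))
            (fun i => i ∉ A)).lintegral_comp_emb (MeasurableEquiv.measurableEmbedding _) G
    _ ≤ ∫⁻ z, ∫⁻ y, G (z, y) := lintegral_prod_le G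
    _ ≤ _ := by
        refine lintegral_mono fun z => ?_
        by_cases hz : z ∈ auxQ d {i // i ∉ A} S v
        swap
        · simp [G, Set.indicator_of_notMem hz]
        simp only [G, Set.indicator_of_mem hz]
        refine (lintegral_indicator_const_le _ _).trans ?_
        rw [volume_pi_pi]
        simp [mul_comm]

lemma auxPA_meas {d k : ℕ} {S : Set (EuclideanSpace ℝ (Fin d))} (hM : MeasurableSet S)
    (v : EuclideanSpace ℝ (Fin d)) (A : Finset (Fin k)) : MeasurableSet
      {x | x ∈ auxP d (Fin k) S ∧ ∀ i, i ∈ A ↔ dist (x i) v ≤ 2 * rd d} := by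
  have h : MeasurableSet {x : Fin k → EuclideanSpace ℝ (Fin d) | ∀ i, i ∈ A ↔ dist (x i) v ≤ 2 * rd d} := by
    rw [Set.ofPred_forall]
    refine MeasurableSet.iInter fun i => ?_
    have h1 : MeasurableSet {x : Fin k → EuclideanSpace ℝ (Fin d) | dist (x i) v ≤ 2 * rd d} :=
      measurableSet_le ((measurable_pi_apply i).dist measurable_const) measurable_const
    by_cases hi : i ∈ A
    · simpa only [hi, true_iff] using h1
    · simp only [hi, false_iff]; exact h1.compl
  exact (auxP_meas (Fin k) hM).inter h

lemma aux_conv (c : ℕ → ℝ≥0∞) (a : ℕ → ℕ → ℝ≥0∞) :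
    ∑' k, ∑ p ∈ Finset.HasAntidiagonal.antidiagonal k, c p.1 * c p.2 * a p.1 p.2 =
      ∑' m, c m * ∑' j, c j * a j m := by
  calc _ = ∑' p : ℕ × ℕ, c p.1 * c p.2 * a p.1 p.2 := by
        rw [← Finset.HasAntidiagonal.sigmaAntidiagonalEquivProd.tsum_eq, ENNReal.tsum_sigma']
        congr 1; ext k
        rw [tsum_fintype]
        exact (Finset.sum_coe_sort (Finset.HasAntidiagonal.antidiagonal k)
          (fun p => c p.1 * c p.2 * a p.1 p.2)).symm
    _ = ∑' m, ∑' j, c j * c m * a j m := by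
        rw [← (Equiv.prodComm ℕ ℕ).tsum_eq, ENNReal.tsum_prod']; rfl
    _ = ∑' m, c m * ∑' j, c j * a j m := by
        congr 1; ext m
        rw [← ENNReal.tsum_mul_left]
        congr 1; ext j; ring

set_option maxHeartbeats 1000000 in
lemma aux_split {d k : ℕ} (S : Set (EuclideanSpace ℝ (Fin d))) (hM : MeasurableSet S)
    (v : EuclideanSpace ℝ (Fin d)) (F : ℝ≥0∞ → ℝ≥0∞) :
    ∫⁻ x in auxP d (Fin k) S, F (volume (auxT d (Fin k) S v x)) ≤
    ∑ j ∈ Finset.range (k + 1), (k.choose j : ℝ≥0∞) *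
      ∫⁻ z in auxQ d (Fin (k - j)) S v,
        volume (auxT d _ S v z) ^ j * F (volume (auxT d _ S v z)) := by
  classical
  have hQ : ∀ m, MeasurableSet (auxQ d (Fin m) S v) := fun m => by
    have := measurable_prodMk_left (x := v) (auxQ_meas (Fin m) hM)
    exact this
  have hmeas := fun A : Finset (Fin k) => auxPA_meas hM v A
  have hU : auxP d (Fin k) S = ⋃ A : Finset (Fin k),
      {x | x ∈ auxP d (Fin k) S ∧ ∀ i, i ∈ A ↔ dist (x i) v ≤ 2 * rd d} := by
    ext x
    simp only [Set.mem_iUnion, Set.mem_ofPred_eq]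
    exact ⟨fun h => ⟨Finset.univ.filter fun i => dist (x i) v ≤ 2 * rd d, h, by simp⟩,
      fun ⟨_, h, _⟩ => h⟩
  rw [hU]
  refine (lintegral_iUnion_le _ _).trans ?_
  rw [tsum_fintype]
  refine (Finset.sum_le_sum fun A _ => (lintegral_indicator (hmeas A) _).symm.le.trans
    (aux_piece S v F A)).trans ?_
  simp_rw [lintegral_indicator (hQ _)]
  rw [← Finset.powerset_univ, Finset.sum_powerset_apply_card (fun j => ∫⁻ z in auxQ d (Fin (k - j)) S v,
        volume (auxT d _ S v z) ^ j * F (volume (auxT d _ S v z)))]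
  simp

lemma aux_hexp {lam : ℝ} (hlam : 0 < lam) (t : ℝ≥0∞) (ht : t ≠ ⊤) :
    ∑' j : ℕ, ENNReal.ofReal (lam ^ j / j.factorial) *
      (t ^ j * ENNReal.ofReal (Real.exp (-(lam * t.toReal)))) = 1 := by
  lift t to NNReal using ht
  have h0 : ∀ j : ℕ, 0 ≤ (lam * (t:ℝ)) ^ j / j.factorial := fun j => by positivity
  have h1 : ∀ j : ℕ, ENNReal.ofReal (lam ^ j / j.factorial) * (t:ℝ≥0∞) ^ j =
      ENNReal.ofReal ((lam * (t:ℝ)) ^ j / j.factorial) := by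
    intro j
    rw [← ENNReal.ofReal_coe_nnreal, ← ENNReal.ofReal_pow t.coe_nonneg,
      ← ENNReal.ofReal_mul (by positivity)]
    congr 1
    rw [mul_pow]; ring
  simp_rw [← mul_assoc, h1]
  rw [ENNReal.tsum_mul_right, ← ENNReal.ofReal_tsum_of_nonneg h0 (Real.summable_pow_div_factorial _),
    (NormedSpace.expSeries_div_hasSum_exp (lam * (t:ℝ))).tsum_eq, ← Real.exp_eq_exp_ℝ,
    ← ENNReal.ofReal_mul (Real.exp_pos _).le, ← Real.exp_add]
  simp

lemma aux_coef {lam : ℝ} (hlam : 0 < lam) {j k : ℕ} (hj' : j ≤ k) :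
    ENNReal.ofReal (lam ^ k / k.factorial) * (k.choose j : ℝ≥0∞) =
    ENNReal.ofReal (lam ^ j / j.factorial) * ENNReal.ofReal (lam ^ (k - j) / (k - j).factorial) := by
  rw [← ENNReal.ofReal_natCast, ← ENNReal.ofReal_mul (by positivity), ← ENNReal.ofReal_mul (by positivity)]
  congr 1
  rw [Nat.cast_choose ℝ hj']
  have : lam ^ k = lam ^ j * lam ^ (k - j) := by rw [← pow_add]; congr 1; omega
  rw [this]
  have : (k.factorial : ℝ) ≠ 0 := by positivity
  field_simp

lemma aux_inner {α : Type*} [MeasurableSpace α] (μ : Measure α) (t : α → ℝ≥0∞) (ht : Measurable t)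
    (ht' : ∀ z, t z ≠ ⊤) {lam : ℝ} (hlam : 0 < lam) :
    ∑' j : ℕ, ENNReal.ofReal (lam ^ j / j.factorial) *
      ∫⁻ z, t z ^ j * ENNReal.ofReal (Real.exp (-(lam * (t z).toReal))) ∂μ = μ Set.univ := by
  have hm : ∀ j : ℕ, Measurable fun z => t z ^ j * ENNReal.ofReal (Real.exp (-(lam * (t z).toReal))) :=
    fun j => by fun_prop
  simp_rw [← lintegral_const_mul _ (hm _)]
  rw [← lintegral_tsum fun j => ((hm j).const_mul _).aemeasurable]
  simp_rw [aux_hexp hlam _ (ht' _)]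
  simp

lemma auxT_ne_top {d : ℕ} {ι : Type} (S : Set (EuclideanSpace ℝ (Fin d)))
    (hS : volume S ≠ ⊤) (v : EuclideanSpace ℝ (Fin d)) (z : ι → EuclideanSpace ℝ (Fin d)) :
    volume (auxT d ι S v z) ≠ ⊤ := by
  have h : auxT d ι S v z ⊆ S := fun p hp => by
    simp only [auxT, Set.mem_ofPred_eq] at hp
    exact hp.1.2
  exact ne_top_of_le_ne_top hS (measure_mono h)

lemma aux_slice {α β : Type*} [MeasurableSpace α] [MeasurableSpace β] (v : α) (f : α → β → ℝ≥0∞)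
    (h : Measurable fun p : α × β => f p.1 p.2) : Measurable (f v) :=
  h.comp measurable_prodMk_left

lemma auxT_slice_meas {d : ℕ} (ι : Type) [Fintype ι] {S : Set (EuclideanSpace ℝ (Fin d))}
    (hM : MeasurableSet S) (v : EuclideanSpace ℝ (Fin d)) :
    Measurable fun z : ι → EuclideanSpace ℝ (Fin d) => volume (auxT d ι S v z) := by
  exact aux_slice v (fun v z => volume (auxT d ι S v z)) (auxT_vol_meas ι hM)

lemma aux_markov {d : ℕ} (S : Set (EuclideanSpace ℝ (Fin d))) (hM : MeasurableSet S)
    (hS : volume S ≠ ⊤) (v : EuclideanSpace ℝ (Fin d)) {lam : ℝ} (hlam : 0 < lam) :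
    ∑' k : ℕ, ENNReal.ofReal (lam ^ k / k.factorial) *
      ∫⁻ x in auxP d (Fin k) S, ENNReal.ofReal (Real.exp (-(lam * (volume (auxT d (Fin k) S v x)).toReal))) ≤
    ∑' k : ℕ, ENNReal.ofReal (lam ^ k / k.factorial) * volume (auxQ d (Fin k) S v) := by
  let a : ℕ → ℕ → ℝ≥0∞ := fun j m => ∫⁻ z in auxQ d (Fin m) S v,
        volume (auxT d _ S v z) ^ j *
          ENNReal.ofReal (Real.exp (-(lam * (volume (auxT d _ S v z)).toReal)))
  have hTS : ∀ m (z : Fin m → EuclideanSpace ℝ (Fin d)), volume (auxT d _ S v z) ≠ ⊤ :=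
    fun m z => auxT_ne_top S hS v z
  have hvm : ∀ m, Measurable fun z : Fin m → EuclideanSpace ℝ (Fin d) => volume (auxT d (Fin m) S v z) :=
    fun m => auxT_slice_meas (Fin m) hM v
  have hstep : ∀ k : ℕ, ENNReal.ofReal (lam ^ k / k.factorial) *
      ∫⁻ x in auxP d (Fin k) S, ENNReal.ofReal (Real.exp (-(lam * (volume (auxT d (Fin k) S v x)).toReal))) ≤
      ∑ p ∈ Finset.HasAntidiagonal.antidiagonal k, ENNReal.ofReal (lam ^ p.1 / p.1.factorial) *
        ENNReal.ofReal (lam ^ p.2 / p.2.factorial) * a p.1 p.2 := by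
    intro k
    rw [Finset.Nat.sum_antidiagonal_eq_sum_range_succ (fun i j => ENNReal.ofReal (lam ^ i / i.factorial) *
        ENNReal.ofReal (lam ^ j / j.factorial) * a i j)]
    have h := aux_split (k := k) S hM v (fun t => ENNReal.ofReal (Real.exp (-(lam * t.toReal))))
    refine (mul_le_mul_right h _).trans ?_
    rw [Finset.mul_sum]
    refine Finset.sum_le_sum fun j hj => ?_
    have hj' : j ≤ k := Nat.lt_succ_iff.1 (Finset.mem_range.1 hj)
    rw [← mul_assoc, aux_coef hlam hj']
  refine (ENNReal.tsum_le_tsum hstep).trans ?_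
  rw [aux_conv (fun k => ENNReal.ofReal (lam ^ k / k.factorial)) a]
  refine ENNReal.tsum_le_tsum fun m => ?_
  have h := aux_inner (volume.restrict (auxQ d (Fin m) S v)) _ (hvm m) (hTS m) hlam
  rw [Measure.restrict_apply_univ] at h
  rw [← h]

lemma auxP_succ {d k : ℕ} (S : Set (EuclideanSpace ℝ (Fin d)))
    (x : Fin (k + 1) → EuclideanSpace ℝ (Fin d)) :
    x ∈ auxP d (Fin (k + 1)) S ↔ x 0 ∈ S ∧ (fun i : Fin k => x i.succ) ∈ auxQ d (Fin k) S (x 0) := by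
  simp only [auxP, auxQ, Set.mem_ofPred_eq]
  constructor
  · rintro ⟨h1, h2⟩
    exact ⟨h1 0, ⟨fun i => h1 _, fun i j hij => h2 _ _ fun h => hij (Fin.succ_injective _ h)⟩,
      fun i => h2 _ _ (Fin.succ_ne_zero i)⟩
  · rintro ⟨h0, ⟨h1, h2⟩, h3⟩
    refine ⟨fun i => Fin.cases h0 h1 i, fun i j => ?_⟩
    refine Fin.cases ?_ (fun i => ?_) i
    · refine Fin.cases ?_ (fun j => ?_) j
      · intro h; exact absurd rfl h
      · intro _; rw [dist_comm]; exact h3 j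
    · refine Fin.cases ?_ (fun j => ?_) j
      · intro _; exact h3 i
      · intro h; exact h2 i j fun e => h (congrArg _ e)

lemma aux_prod_vol {α β : Type*} [MeasurableSpace α] [MeasurableSpace β] (μ : Measure α)
    (ν : Measure β) [SFinite ν] (S : Set α) (hM : MeasurableSet S) (Q : α → Set β)
    (hQ : MeasurableSet {p : α × β | p.2 ∈ Q p.1}) :
    (μ.prod ν) ({p | p.1 ∈ S} ∩ {p | p.2 ∈ Q p.1}) = ∫⁻ v in S, ν (Q v) ∂μ := by
  have hs : MeasurableSet ({p : α × β | p.1 ∈ S} ∩ {p | p.2 ∈ Q p.1}) :=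
    (measurable_fst hM).inter hQ
  rw [Measure.prod_apply hs, ← lintegral_indicator hM]
  congr 1
  ext v
  by_cases hv : v ∈ S
  · rw [Set.indicator_of_mem hv]
    congr 1
    ext x
    simp [hv]
  · rw [Set.indicator_of_notMem hv]
    have : Prod.mk v ⁻¹' ({p : α × β | p.1 ∈ S} ∩ {p | p.2 ∈ Q p.1}) = ∅ := by
      ext x
      simp [hv]
    rw [this, measure_empty]

lemma aux_vol_succ {d : ℕ} (k : ℕ) {S : Set (EuclideanSpace ℝ (Fin d))} (hM : MeasurableSet S) :
    volume (auxP d (Fin (k + 1)) S) = ∫⁻ v in S, volume (auxQ d (Fin k) S v) := by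
  rw [← aux_prod_vol volume volume S hM (fun v => auxQ d (Fin k) S v) (auxQ_meas (Fin k) hM)]
  have hp := volume_preserving_piFinSuccAbove (fun _ : Fin (k + 1) => EuclideanSpace ℝ (Fin d)) 0
  rw [← Measure.volume_eq_prod, ← hp.measure_preimage_equiv]
  congr 1
  ext x
  exact auxP_succ S x

lemma aux_vol_le {d : ℕ} (k : ℕ) (S : Set (EuclideanSpace ℝ (Fin d))) :
    volume (auxP d (Fin k) S) ≤ volume S ^ k := by
  have h : auxP d (Fin k) S ⊆ Set.univ.pi fun _ => S := fun x hx i _ => hx.1 i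
  refine (measure_mono h).trans ?_
  rw [volume_pi_pi]
  simp

lemma aux_markov2 {d : ℕ} (S : Set (EuclideanSpace ℝ (Fin d))) (hM : MeasurableSet S)
    (hS : volume S ≠ ⊤) {lam : ℝ} (hlam : 0 < lam) :
    ∑' k : ℕ, ENNReal.ofReal (lam ^ k / k.factorial) *
      ∫⁻ p, ENNReal.ofReal (Real.exp (-(lam * (volume (auxT d (Fin k) S p.1 p.2)).toReal)))
        ∂((volume.restrict S).prod (volume.restrict (auxP d (Fin k) S))) ≤
    ∑' k : ℕ, ENNReal.ofReal (lam ^ k / k.factorial) * volume (auxP d (Fin (k + 1)) S) := by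
  have hm : ∀ k, Measurable fun p : EuclideanSpace ℝ (Fin d) × (Fin k → EuclideanSpace ℝ (Fin d)) =>
      ENNReal.ofReal (Real.exp (-(lam * (volume (auxT d (Fin k) S p.1 p.2)).toReal))) := by
    intro k
    have := auxT_vol_meas (Fin k) hM
    fun_prop
  have hq : ∀ k, Measurable fun v => volume (auxQ d (Fin k) S v) := fun k =>
    measurable_measure_prodMk_left (auxQ_meas (Fin k) hM)
  simp_rw [aux_vol_succ _ hM]
  simp_rw [lintegral_prod _ (hm _).aemeasurable]
  simp_rw [← lintegral_const_mul _ (hm _).lintegral_prod_right', ← lintegral_const_mul _ (hq _)]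
  rw [← lintegral_tsum fun k => ((hm k).lintegral_prod_right'.const_mul _).aemeasurable,
    ← lintegral_tsum fun k => ((hq k).const_mul _).aemeasurable]
  exact lintegral_mono fun v => aux_markov S hM hS v hlam

/-- tangent line bound for a bounded function on a finite measure space -/
lemma aux_jensen {α : Type*} [MeasurableSpace α] (μ : Measure α) [IsFiniteMeasure μ] (t : α → ℝ)
    (ht : Measurable t) (C : ℝ) (h0 : ∀ a, 0 ≤ t a) (hC : ∀ a, t a ≤ C) {lam : ℝ} (hlam : 0 < lam)
    (m : ℝ) :
    Integrable t μ ∧ Integrable (fun a => Real.exp (-(lam * t a))) μ ∧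
    0 ≤ ∫ a, t a ∂μ ∧ ∫ a, t a ∂μ ≤ C * μ.real Set.univ ∧
    0 ≤ ∫ a, Real.exp (-(lam * t a)) ∂μ ∧ ∫ a, Real.exp (-(lam * t a)) ∂μ ≤ μ.real Set.univ ∧
    Real.exp (-m) * ((1 + m) * μ.real Set.univ - lam * ∫ a, t a ∂μ) ≤
      ∫ a, Real.exp (-(lam * t a)) ∂μ := by
  have i1 : Integrable t μ := Integrable.of_bound ht.aestronglyMeasurable C
    (ae_of_all _ fun a => by rw [Real.norm_of_nonneg (h0 a)]; exact hC a)
  have e1 : ∀ a, Real.exp (-(lam * t a)) ≤ 1 := fun a =>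
    Real.exp_le_one_iff.2 (neg_nonpos.2 (mul_nonneg hlam.le (h0 a)))
  have i2 : Integrable (fun a => Real.exp (-(lam * t a))) μ :=
    Integrable.of_bound (by fun_prop) 1
      (ae_of_all _ fun a => by rw [Real.norm_of_nonneg (Real.exp_pos _).le]; exact e1 a)
  refine ⟨i1, i2, integral_nonneg h0, ?_, integral_nonneg fun a => (Real.exp_pos _).le, ?_, ?_⟩
  · have := integral_mono i1 (integrable_const C) hC
    simpa [mul_comm] using this
  · have := integral_mono i2 (integrable_const 1) e1
    simpa using this
  · have i3 : Integrable (fun a => Real.exp (-m) * ((1 + m) - lam * t a)) μ :=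
      ((integrable_const _).sub (i1.const_mul lam)).const_mul _
    have := integral_mono i3 i2 fun a => by
      show Real.exp (-m) * ((1 + m) - lam * t a) ≤ Real.exp (-(lam * t a))
      have h := Real.add_one_le_exp (m - lam * t a)
      have e : Real.exp (-(lam * t a)) = Real.exp (-m) * Real.exp (m - lam * t a) := by
        rw [← Real.exp_add]; ring_nf
      rw [e]
      exact mul_le_mul_of_nonneg_left (by linarith) (Real.exp_pos _).le
    rw [integral_const_mul, integral_sub (integrable_const _) (i1.const_mul lam), integral_const_mul] at this
    simpa [mul_comm] using this

end aux

/-- `α_S(λ) ≥ λ exp(-λ E[vol(T(v,X))])`. -/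
theorem alphaS_ge_lam_exp_neg_expected_volT (d : ℕ) (S : Set (EuclideanSpace ℝ (Fin d)))
    (hB : Bornology.IsBounded S) (hM : MeasurableSet S) (hv : 0 < volume S)
    (lam : ℝ) (hlam : 0 < lam) :
    alphaS d S lam ≥
      lam * Real.exp (-(lam *
        ExpT d S lam (fun v _k x => (volume (Treg d S v x)).toReal))) := by
  have hS : volume S ≠ ⊤ := hB.measure_lt_top.ne
  set V := (volume S).toReal with hV
  have hVpos : 0 < V := ENNReal.toReal_pos hv.ne' hS
  have hPtop : ∀ k, volume (auxP d (Fin k) S) ≠ ⊤ := fun k =>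
    ne_top_of_le_ne_top (ENNReal.pow_ne_top hS) (aux_vol_le k S)
  let p : ℕ → ℝ := fun k => (volume (auxP d (Fin k) S)).toReal
  have hp0 : ∀ k, 0 ≤ p k := fun k => ENNReal.toReal_nonneg
  have hpV : ∀ k, p k ≤ V ^ k := fun k => by
    have := ENNReal.toReal_mono (ENNReal.pow_ne_top hS) (aux_vol_le k S)
    rwa [ENNReal.toReal_pow] at this
  let c : ℕ → ℝ := fun k => lam ^ k / k.factorial
  have hc0 : ∀ k, 0 ≤ c k := fun k => by positivity
  have hZhat : ∀ k, Zhat d S k = 1 / (k.factorial : ℝ) * p k := by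
    intro k
    have : packSet d k S = auxP d (Fin k) S := rfl
    rw [Zhat, this, integral_indicator_const _ (auxP_meas (Fin k) hM)]
    simp [p, Measure.real]
  have hterm : ∀ k, lam ^ k * Zhat d S k = c k * p k := fun k => by rw [hZhat]; simp only [c]; ring
  have hsumV : Summable fun k => c k * V ^ k := by
    refine (Real.summable_pow_div_factorial (lam * V)).congr fun k => ?_
    simp only [c]; rw [mul_pow]; ring
  have hsp : Summable fun k => c k * p k := Summable.of_nonneg_of_le
    (fun k => mul_nonneg (hc0 k) (hp0 k)) (fun k => mul_le_mul_of_nonneg_left (hpV k) (hc0 k)) hsumV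
  have hZ : Zgc d S lam = ∑' k, c k * p k := by rw [Zgc]; exact tsum_congr hterm
  set Z := Zgc d S lam with hZdef
  have hZpos : 0 < Z := by
    rw [hZ]
    refine hsp.tsum_pos (fun k => mul_nonneg (hc0 k) (hp0 k)) 0 ?_
    have : auxP d (Fin 0) S = Set.univ := by
      ext x; simp [auxP]
    simp [c, p, this, volume_pi]
  -- the product measures
  let ν : ∀ k : ℕ, Measure (EuclideanSpace ℝ (Fin d) × (Fin k → EuclideanSpace ℝ (Fin d))) :=
    fun k => (volume.restrict S).prod (volume.restrict (auxP d (Fin k) S))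
  have hf1 : IsFiniteMeasure (volume.restrict S) := ⟨by simpa using hS.lt_top⟩
  have hf2 : ∀ k, IsFiniteMeasure (volume.restrict (auxP d (Fin k) S)) :=
    fun k => ⟨by simpa using (hPtop k).lt_top⟩
  have hνu : ∀ k, (ν k).real Set.univ = V * p k := by
    intro k
    simp only [ν, Measure.real]
    rw [← Set.univ_prod_univ, Measure.prod_prod]
    simp [p, hV]
  let t : ∀ k : ℕ, EuclideanSpace ℝ (Fin d) × (Fin k → EuclideanSpace ℝ (Fin d)) → ℝ :=
    fun k q => (volume (auxT d (Fin k) S q.1 q.2)).toReal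
  have htm : ∀ k, Measurable (t k) := fun k => (auxT_vol_meas (Fin k) hM).ennreal_toReal
  have ht0 : ∀ k q, 0 ≤ t k q := fun k q => ENNReal.toReal_nonneg
  have htV : ∀ k q, t k q ≤ V := fun k q => by
    have h : auxT d (Fin k) S q.1 q.2 ⊆ S := fun p hp => by
      simp only [auxT, Set.mem_ofPred_eq] at hp
      exact hp.1.2
    exact ENNReal.toReal_mono hS (measure_mono h)
  let I : ℕ → ℝ := fun k => ∫ q, t k q ∂(ν k)
  let J : ℕ → ℝ := fun k => ∫ q, Real.exp (-(lam * t k q)) ∂(ν k)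
  have key := fun k m => aux_jensen (ν k) (t k) (htm k) V (ht0 k) (htV k) hlam m
  simp only [hνu] at key
  have hE : ExpT d S lam (fun v _k x => (volume (Treg d S v x)).toReal) =
      1 / (V * Z) * ∑' k, c k * I k := by
    rw [ExpT]
    congr 1
    refine tsum_congr fun k => ?_
    congr 1
    simp only [I, ν]
    rw [integral_prod _ (key k 0).1]
    refine integral_congr_ae (ae_of_all _ fun v => ?_)
    exact integral_indicator (auxP_meas (Fin k) hM)
  have hsI : Summable fun k => c k * I k := by
    refine Summable.of_nonneg_of_le (fun k => mul_nonneg (hc0 k) (key k 0).2.2.1)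
      (fun k => mul_le_mul_of_nonneg_left (key k 0).2.2.2.1 (hc0 k)) ?_
    refine (hsp.mul_left (V * V)).congr fun k => ?_
    ring
  have hsJ : Summable fun k => c k * J k := by
    refine Summable.of_nonneg_of_le (fun k => mul_nonneg (hc0 k) (key k 0).2.2.2.2.1)
      (fun k => mul_le_mul_of_nonneg_left (key k 0).2.2.2.2.2.1 (hc0 k)) ?_
    refine (hsp.mul_left V).congr fun k => ?_
    ring
  have hsp1 : Summable fun k => c k * p (k + 1) := by
    refine Summable.of_nonneg_of_le (fun k => mul_nonneg (hc0 k) (hp0 _))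
      (fun k => mul_le_mul_of_nonneg_left (hpV _) (hc0 k)) ?_
    refine (hsumV.mul_left V).congr fun k => ?_
    ring
  -- Markov step
  have hJp : ∑' k, c k * J k ≤ ∑' k, c k * p (k + 1) := by
    have h := aux_markov2 S hM hS hlam
    have h1 : ∀ k : ℕ, ENNReal.ofReal (lam ^ k / k.factorial) *
      ∫⁻ p, ENNReal.ofReal (Real.exp (-(lam * (volume (auxT d (Fin k) S p.1 p.2)).toReal)))
        ∂((volume.restrict S).prod (volume.restrict (auxP d (Fin k) S))) =
        ENNReal.ofReal (c k * J k) := by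
      intro k
      rw [ENNReal.ofReal_mul (hc0 k), ofReal_integral_eq_lintegral_ofReal (key k 0).2.1
        (ae_of_all _ fun _ => (Real.exp_pos _).le)]
    have h2 : ∀ k : ℕ, ENNReal.ofReal (lam ^ k / k.factorial) * volume (auxP d (Fin (k + 1)) S) =
        ENNReal.ofReal (c k * p (k + 1)) := by
      intro k
      rw [ENNReal.ofReal_mul (hc0 k), ENNReal.ofReal_toReal (hPtop _)]
    simp_rw [h1, h2] at h
    rw [← ENNReal.ofReal_tsum_of_nonneg (fun k => mul_nonneg (hc0 k) (key k 0).2.2.2.2.1) hsJ,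
      ← ENNReal.ofReal_tsum_of_nonneg (fun k => mul_nonneg (hc0 k) (hp0 _)) hsp1] at h
    exact (ENNReal.ofReal_le_ofReal_iff (tsum_nonneg fun k => mul_nonneg (hc0 k) (hp0 _))).1 h
  have hnum : ∑' k : ℕ, (k : ℝ) * lam ^ k * Zhat d S k = lam * ∑' k, c k * p (k + 1) := by
    have hs : ∀ k : ℕ, ((k + 1 : ℕ) : ℝ) * lam ^ (k + 1) * Zhat d S (k + 1) = lam * (c k * p (k + 1)) := by
      intro k
      rw [hZhat, Nat.factorial_succ]
      simp only [c]
      have : (k.factorial : ℝ) ≠ 0 := by positivity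
      push_cast
      field_simp
      ring
    rw [tsum_eq_zero_add' ((hsp1.mul_left lam).congr fun k => (hs k).symm), tsum_congr hs, tsum_mul_left]
    simp
  rw [hE]
  set N := ∑' k, c k * I k with hN
  set m := lam * (1 / (V * Z) * N) with hm
  have hVZ : 0 < V * Z := mul_pos hVpos hZpos
  have hjen : Real.exp (-m) * (V * Z) ≤ ∑' k, c k * J k := by
    have h1 : Summable fun k => Real.exp (-m) * ((1 + m) * V * (c k * p k) - lam * (c k * I k)) :=
      ((hsp.mul_left _).sub (hsI.mul_left _)).mul_left _
    have h2 := h1.tsum_le_tsum (fun k => ?_) hsJ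
    · rw [tsum_mul_left, (hsp.mul_left _).tsum_sub (hsI.mul_left _), tsum_mul_left, tsum_mul_left,
        ← hZ, ← hN] at h2
      refine le_trans (le_of_eq ?_) h2
      have : m * (V * Z) = lam * N := by rw [hm]; field_simp
      linear_combination (-Real.exp (-m)) * this
    · have := mul_le_mul_of_nonneg_left (key k m).2.2.2.2.2.2 (hc0 k)
      refine le_trans (le_of_eq ?_) this
      simp only [I]; ring
  rw [alphaS, hnum, ge_iff_le, ← hV, ← hZdef, le_div_iff₀ hVZ, mul_assoc]
  exact mul_le_mul_of_nonneg_left (hjen.trans hJp) hlam.le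
end

section
/- Let d ≥ 1 and let S ⊆ B_{2r_d}(0) be measurable. Then ∫_S ∫_S 1[|u − v| ≤ 2 r_d] dv du ≤ 2 · 3^{d/2} · vol(S). Equivalently, if vol(S) > 0 and u is a uniformly random point of S, then E[vol(B_{2r_d}(u) ∩ S)] ≤ 2 · 3^{d/2}. -/
open MeasureTheory Filter

lemma lens_subset {E : Type*} [NormedAddCommGroup E] [InnerProductSpace ℝ E] (r : ℝ) (hr : 0 ≤ r)
    (u v : E) (hu : ‖u‖ ≤ 2 * r) (hv : ‖v‖ ≤ ‖u‖) (huv : dist u v ≤ 2 * r) :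
    v ∈ Metric.closedBall ((1 / 2 : ℝ) • u) (Real.sqrt 3 * r) := by
  rw [Metric.mem_closedBall, dist_eq_norm]
  rw [dist_eq_norm] at huv
  have h1 : ‖u - v‖ ^ 2 ≤ (2 * r) ^ 2 := by gcongr
  have h2 : ‖u‖ ^ 2 ≤ (2 * r) ^ 2 := by gcongr
  have h3 : ‖v‖ ^ 2 ≤ ‖u‖ ^ 2 := by gcongr
  apply le_of_sq_le_sq _ (by positivity)
  rw [mul_pow, Real.sq_sqrt (by norm_num)]
  rw [norm_sub_sq_real] at h1 ⊢
  rw [inner_smul_right, norm_smul, real_inner_comm]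
  norm_num
  nlinarith

lemma rd_nonneg (d : ℕ) : 0 ≤ rd d := by unfold rd; positivity

lemma vol_ball (d : ℕ) (hd : 1 ≤ d) (c : EuclideanSpace ℝ (Fin d)) :
    volume (Metric.closedBall c (Real.sqrt 3 * rd d)) = ENNReal.ofReal ((3 : ℝ) ^ ((d : ℝ) / 2)) := by
  have hr := rd_nonneg d
  have hd' : (d : ℝ) ≠ 0 := by positivity
  rw [Measure.addHaar_closedBall' _ _ (by positivity)]
  have hfin : volume (Metric.closedBall (0 : EuclideanSpace ℝ (Fin d)) 1) ≠ ⊤ :=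
    measure_closedBall_lt_top.ne
  have hpos : 0 < (volume (Metric.closedBall (0 : EuclideanSpace ℝ (Fin d)) 1)).toReal :=
    ENNReal.toReal_pos (Metric.measure_closedBall_pos _ _ one_pos).ne' hfin
  rw [← ENNReal.ofReal_toReal hfin, ← ENNReal.ofReal_mul (by positivity)]
  congr 1
  rw [finrank_euclideanSpace_fin, mul_pow]
  have h1 : Real.sqrt 3 ^ d = (3 : ℝ) ^ ((d : ℝ) / 2) := by
    rw [Real.sqrt_eq_rpow, ← Real.rpow_natCast, ← Real.rpow_mul (by norm_num)]
    congr 1; ring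
  have h2 : rd d ^ d = ((volume (Metric.closedBall (0 : EuclideanSpace ℝ (Fin d)) 1)).toReal)⁻¹ := by
    unfold rd
    rw [← Real.rpow_natCast, ← Real.rpow_mul hpos.le, div_mul_cancel₀ _ hd', Real.rpow_neg_one]
  rw [h1, h2, mul_assoc, inv_mul_cancel₀ hpos.ne', mul_one]

/-- for measurable `S ⊆ B_{2 r_d}(0)`,
`∫_S ∫_S 1[|u - v| ≤ 2 r_d] dv du ≤ 2 ⋅ 3^{d/2} vol(S)`. -/
theorem expected_intersection_volume_le (d : ℕ) (hd : 1 ≤ d)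
    (S : Set (EuclideanSpace ℝ (Fin d)))
    (hS : S ⊆ Metric.closedBall 0 (2 * rd d)) (hM : MeasurableSet S) :
    (∫ u in S, ∫ v in S, (if dist u v ≤ 2 * rd d then (1 : ℝ) else 0))
      ≤ 2 * (3 : ℝ) ^ ((d : ℝ) / 2) * (volume S).toReal := by
  have hr := rd_nonneg d
  have hfin : volume S ≠ ⊤ := ((measure_mono hS).trans_lt measure_closedBall_lt_top).ne
  set μ := volume.restrict S with hμ
  have : IsFiniteMeasure μ := isFiniteMeasure_restrict.2 hfin
  let A : Set (EuclideanSpace ℝ (Fin d) × EuclideanSpace ℝ (Fin d)) :=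
    {p | dist p.1 p.2 ≤ 2 * rd d}
  let B : Set (EuclideanSpace ℝ (Fin d) × EuclideanSpace ℝ (Fin d)) :=
    {p | dist p.1 p.2 ≤ 2 * rd d ∧ ‖p.2‖ ≤ ‖p.1‖}
  have hA : MeasurableSet A := measurableSet_le (by fun_prop) (by fun_prop)
  have hB : MeasurableSet B :=
    hA.inter (measurableSet_le measurable_snd.norm measurable_fst.norm)
  have hBle : μ.prod μ B ≤ ENNReal.ofReal ((3 : ℝ) ^ ((d : ℝ) / 2)) * volume S := by
    rw [Measure.prod_apply hB]
    calc ∫⁻ x, μ (Prod.mk x ⁻¹' B) ∂μ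
        ≤ ∫⁻ x, ENNReal.ofReal ((3 : ℝ) ^ ((d : ℝ) / 2)) ∂μ := by
          apply lintegral_mono_ae
          filter_upwards [ae_restrict_mem hM] with u hu
          have hu' : ‖u‖ ≤ 2 * rd d := by simpa using hS hu
          rw [← vol_ball d hd ((1 / 2 : ℝ) • u)]
          refine (Measure.restrict_apply_le _ _).trans (measure_mono ?_)
          intro v hv
          exact lens_subset _ hr u v hu' hv.2 hv.1
      _ = _ := by rw [lintegral_const, hμ, Measure.restrict_apply_univ]
  have hAle : μ.prod μ A ≤ 2 * μ.prod μ B := by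
    have hsub : A ⊆ B ∪ Prod.swap ⁻¹' B := by
      rintro ⟨u, v⟩ h
      change dist u v ≤ _ at h
      rcases le_total ‖v‖ ‖u‖ with h' | h'
      · exact Or.inl ⟨h, h'⟩
      · exact Or.inr ⟨by rw [dist_comm] at h; exact h, h'⟩
    have hsw : μ.prod μ (Prod.swap ⁻¹' B) = μ.prod μ B :=
      Measure.measurePreserving_swap.measure_preimage hB.nullMeasurableSet
    calc _ ≤ _ := measure_mono hsub
      _ ≤ _ := measure_union_le _ _
      _ = _ := by rw [hsw, two_mul]
  have hint : (∫ u, ∫ v, (if dist u v ≤ 2 * rd d then (1 : ℝ) else 0) ∂μ ∂μ)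
      = (μ.prod μ A).toReal := by
    have hi : Integrable (A.indicator (fun _ => (1 : ℝ))) (μ.prod μ) :=
      (integrable_const 1).indicator hA
    have := integral_prod _ hi
    rw [integral_indicator_const _ hA, smul_eq_mul, mul_one] at this
    exact this.symm
  rw [hint]
  refine (ENNReal.toReal_mono ?_ (hAle.trans (mul_le_mul_right hBle 2))).trans_eq ?_
  · exact ENNReal.mul_ne_top (by simp) (ENNReal.mul_ne_top (by simp) hfin)
  · rw [ENNReal.toReal_mul, ENNReal.toReal_mul, ENNReal.toReal_ofReal (by positivity)]
    simp [mul_assoc]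
end

section
/- Let d ≥ 1, r > 0, t ∈ [√2, 2], and let u ∈ ℝ^d with |u| = t·r. Then vol(B_{2r}(u) ∩ B_{tr}(0)) ≤ vol(B_{2r√(1 − t^{-2})}(0)). In particular, taking r = r_d (the radius of a ball of volume 1 in ℝ^d), vol(B_{2r_d}(u) ∩ B_{t r_d}(0)) ≤ (2√(1 − t^{-2}))^d. -/
open MeasureTheory Filter

theorem lens_volume_le (d : ℕ) (r t : ℝ) (hr : 0 < r)
    (ht : t ∈ Set.Icc (Real.sqrt 2) 2) (u : EuclideanSpace ℝ (Fin d))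
    (hu : ‖u‖ = t * r) :
    volume (Metric.closedBall u (2 * r) ∩ Metric.closedBall 0 (t * r)) ≤
        volume (Metric.closedBall (0 : EuclideanSpace ℝ (Fin d))
          (2 * r * Real.sqrt (1 - (t ^ 2)⁻¹))) := by
  obtain ⟨h1, h2⟩ := ht
  have ht0 : 0 < t := lt_of_lt_of_le (by positivity) h1
  have ht2 : 2 ≤ t ^ 2 := by
    have := Real.sq_sqrt (show (0 : ℝ) ≤ 2 by norm_num)
    nlinarith [Real.sqrt_nonneg 2]
  have hti : (t ^ 2)⁻¹ ≤ 1 / 2 := by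
    rw [inv_eq_one_div]
    exact one_div_le_one_div_of_le (by norm_num) ht2
  have hti0 : 0 < (t ^ 2)⁻¹ := by positivity
  have hmul : t ^ 2 * (t ^ 2)⁻¹ = 1 := mul_inv_cancel₀ (by positivity)
  set w := (t ^ 2)⁻¹ with hw
  have hsub : Metric.closedBall u (2 * r) ∩ Metric.closedBall 0 (t * r) ⊆
      Metric.closedBall ((1 - 2 * w) • u) (2 * r * Real.sqrt (1 - w)) := by
    rintro x ⟨hx1, hx2⟩
    rw [mem_closedBall_iff_norm] at hx1 hx2 ⊢
    rw [sub_zero] at hx2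
    have e1 : ‖x - u‖ ^ 2 ≤ (2 * r) ^ 2 := by gcongr
    have e2 : ‖x‖ ^ 2 ≤ (t * r) ^ 2 := by gcongr
    rw [@norm_sub_sq_real] at e1
    apply le_of_sq_le_sq _ (by positivity)
    rw [@norm_sub_sq_real, inner_smul_right, norm_smul, mul_pow, mul_pow,
      Real.sq_sqrt (by linarith), Real.norm_eq_abs, sq_abs, hu]
    rw [hu] at e1
    have e3 : (1 - 2 * w) * (‖x‖ ^ 2 - 2 * inner ℝ x u + (t * r) ^ 2)
        ≤ (1 - 2 * w) * (2 * r) ^ 2 :=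
      mul_le_mul_of_nonneg_left e1 (by linarith)
    have e4 : 2 * w * ‖x‖ ^ 2 ≤ 2 * w * (t * r) ^ 2 :=
      mul_le_mul_of_nonneg_left e2 (by linarith)
    have e5 : w * (t * r) ^ 2 = r ^ 2 := by linear_combination r ^ 2 * hmul
    have e6 : w ^ 2 * (t * r) ^ 2 = w * r ^ 2 := by linear_combination w * e5
    nlinarith
  refine (measure_mono hsub).trans (le_of_eq ?_)
  rw [Measure.addHaar_closedBall_center]

/-- for `t ∈ [√2, 2]` and `|u| = t r`,
`vol(B_{2r}(u) ∩ B_{tr}(0)) ≤ vol(B_{2r√(1 - t⁻²)}(0))`; in particular for `r = r_d`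
the intersection has volume at most `(2√(1 - t⁻²))^d`. -/
theorem ball_intersection_volume_le (d : ℕ) (hd : 1 ≤ d) (r t : ℝ) (hr : 0 < r)
    (ht : t ∈ Set.Icc (Real.sqrt 2) 2) (u : EuclideanSpace ℝ (Fin d))
    (hu : ‖u‖ = t * r) :
    volume (Metric.closedBall u (2 * r) ∩ Metric.closedBall 0 (t * r)) ≤
        volume (Metric.closedBall (0 : EuclideanSpace ℝ (Fin d))
          (2 * r * Real.sqrt (1 - (t ^ 2)⁻¹))) ∧
      ∀ u' : EuclideanSpace ℝ (Fin d), ‖u'‖ = t * rd d →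
        (volume (Metric.closedBall u' (2 * rd d) ∩ Metric.closedBall 0 (t * rd d))).toReal
          ≤ (2 * Real.sqrt (1 - (t ^ 2)⁻¹)) ^ d := by
  refine ⟨lens_volume_le d r t hr ht u hu, fun u' hu' => ?_⟩
  set V := volume (Metric.closedBall (0 : EuclideanSpace ℝ (Fin d)) 1) with hV
  have hVtop : V ≠ ⊤ := measure_closedBall_lt_top.ne
  have hV0 : 0 < V.toReal :=
    ENNReal.toReal_pos (Metric.measure_closedBall_pos volume _ one_pos).ne' hVtop
  have hrd : 0 < rd d := Real.rpow_pos_of_pos hV0 _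
  have hpow : rd d ^ d * V.toReal = 1 := by
    have hd0 : (d : ℝ) ≠ 0 := by positivity
    have : rd d ^ d = V.toReal⁻¹ := by
      rw [rd, ← Real.rpow_natCast, ← Real.rpow_mul hV0.le, div_mul_cancel₀ _ hd0,
        Real.rpow_neg_one]
    rw [this, inv_mul_cancel₀ hV0.ne']
  have key := lens_volume_le d (rd d) t hrd ht u' hu'
  refine (ENNReal.toReal_mono measure_closedBall_lt_top.ne key).trans (le_of_eq ?_)
  rw [Measure.addHaar_closedBall' _ _ (by positivity), ENNReal.toReal_mul,
    ENNReal.toReal_ofReal (by positivity), finrank_euclideanSpace_fin, ← hV]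
  linear_combination (2 * Real.sqrt (1 - (t ^ 2)⁻¹)) ^ d * hpow
end

section
/- Fix c with log(3)/2 < c < log 2. For every ε > 0 there exists d₀ such that for all dimensions d ≥ d₀, every bounded measurable S ⊆ ℝ^d with vol(S) > 0, and λ = e^{-c·d}, the expected packing density satisfies α_S(λ) ≥ (1 − ε) · (log 2 − c) · d · 2^{-d}. -/
open MeasureTheory Filter

open scoped ENNReal

/-- Unnormalised grand canonical expectation. -/
noncomputable def Eint (d : ℕ) (S : Set (EuclideanSpace ℝ (Fin d))) (l : ℝ≥0∞)
    (F : ∀ k : ℕ, (Fin k → EuclideanSpace ℝ (Fin d)) → ℝ≥0∞) : ℝ≥0∞ :=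
  ∑' k : ℕ, l ^ k / (Nat.factorial k : ℝ≥0∞) * ∫⁻ x in packSet d k S, F k x

/-- Uncovered region. -/
def Ureg (d : ℕ) {k : ℕ} (x : Fin k → EuclideanSpace ℝ (Fin d)) :
    Set (EuclideanSpace ℝ (Fin d)) :=
  {u | ∀ i, dist u (x i) > 2 * rd d}

lemma measurableSet_packSet (d k : ℕ) {S : Set (EuclideanSpace ℝ (Fin d))}
    (hS : MeasurableSet S) : MeasurableSet (packSet d k S) := by
  have h1 : MeasurableSet {x : Fin k → EuclideanSpace ℝ (Fin d) | ∀ i, x i ∈ S} := by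
    rw [Set.ofPred_forall]
    exact MeasurableSet.iInter fun i => (measurable_pi_apply i) hS
  have h2 : MeasurableSet {x : Fin k → EuclideanSpace ℝ (Fin d) |
      ∀ i j, i ≠ j → dist (x i) (x j) > 2 * rd d} := by
    simp only [Set.ofPred_forall]
    refine MeasurableSet.iInter fun i => MeasurableSet.iInter fun j => MeasurableSet.iInter fun _ => ?_
    exact measurableSet_lt measurable_const
      ((measurable_pi_apply i).dist (measurable_pi_apply j))
  exact h1.inter h2

lemma measurableSet_Ureg_prod (d k : ℕ) :
    MeasurableSet {p : (Fin k → EuclideanSpace ℝ (Fin d)) × EuclideanSpace ℝ (Fin d) |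
      p.2 ∈ Ureg d p.1} := by
  have : {p : (Fin k → EuclideanSpace ℝ (Fin d)) × EuclideanSpace ℝ (Fin d) |
      p.2 ∈ Ureg d p.1} = ⋂ i, {p | dist p.2 (p.1 i) > 2 * rd d} := by
    ext p; simp [Ureg]
  rw [this]
  refine MeasurableSet.iInter fun i => ?_
  exact measurableSet_lt measurable_const
    (measurable_snd.dist ((measurable_pi_apply i).comp measurable_fst))

lemma measurableSet_Ureg (d k : ℕ) (x : Fin k → EuclideanSpace ℝ (Fin d)) :
    MeasurableSet (Ureg d x) :=
  measurable_prodMk_left (measurableSet_Ureg_prod d k)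

lemma insertNth_mem_packSet (d k : ℕ) (S : Set (EuclideanSpace ℝ (Fin d))) (i : Fin (k + 1))
    (u : EuclideanSpace ℝ (Fin d)) (y : Fin k → EuclideanSpace ℝ (Fin d)) :
    (i.insertNth u y : Fin (k + 1) → EuclideanSpace ℝ (Fin d)) ∈ packSet d (k + 1) S ↔
      y ∈ packSet d k S ∧ u ∈ S ∩ Ureg d y := by
  simp only [packSet, Ureg, Set.mem_ofPred_eq, Set.mem_inter_iff]
  rw [Fin.forall_iff_succAbove i, Fin.forall_iff_succAbove i]
  simp only [Fin.insertNth_apply_same, Fin.insertNth_apply_succAbove]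
  have e1 : (∀ j : Fin (k+1), i ≠ j → dist u ((i.insertNth u y : Fin (k + 1) → EuclideanSpace ℝ (Fin d)) j) > 2 * rd d) ↔
      ∀ j, dist u (y j) > 2 * rd d := by
    rw [Fin.forall_iff_succAbove i]
    simp [Fin.insertNth_apply_succAbove, (Fin.succAbove_ne i _).symm]
  have e2 : (∀ a : Fin k, ∀ j : Fin (k+1), i.succAbove a ≠ j →
        dist (y a) ((i.insertNth u y : Fin (k + 1) → EuclideanSpace ℝ (Fin d)) j) > 2 * rd d) ↔
      (∀ j, dist u (y j) > 2 * rd d) ∧ ∀ a b, a ≠ b → dist (y a) (y b) > 2 * rd d := by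
    simp only [Fin.forall_iff_succAbove (P := fun j => _ ≠ j → _) i]
    simp [Fin.insertNth_apply_succAbove, (Fin.succAbove_ne i _), forall_and, dist_comm]
  rw [e1, e2]
  tauto

lemma mecke_one (d k : ℕ) {S : Set (EuclideanSpace ℝ (Fin d))} (hS : MeasurableSet S)
    (i : Fin (k + 1)) (F : (Fin (k + 1) → EuclideanSpace ℝ (Fin d)) → ℝ≥0∞)
    (hF : Measurable F)
    (G : EuclideanSpace ℝ (Fin d) → (Fin k → EuclideanSpace ℝ (Fin d)) → ℝ≥0∞)
    (hG : ∀ u y, F (i.insertNth u y : Fin (k + 1) → EuclideanSpace ℝ (Fin d)) = G u y) :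
    ∫⁻ x in packSet d (k + 1) S, F x =
      ∫⁻ y in packSet d k S, ∫⁻ u in S ∩ Ureg d y, G u y := by
  classical
  rw [← lintegral_indicator (measurableSet_packSet d _ hS),
    ← lintegral_indicator (measurableSet_packSet d _ hS)]
  have hmp := (volume_preserving_piFinSuccAbove
    (fun _ : Fin (k + 1) => EuclideanSpace ℝ (Fin d)) i).symm
  rw [MeasurePreserving.lintegral_map_equiv _ _ hmp, Measure.volume_eq_prod, lintegral_prod_symm]
  · apply lintegral_congr
    intro y
    by_cases hy : y ∈ packSet d k S
    · rw [Set.indicator_of_mem hy, ← lintegral_indicator (hS.inter (measurableSet_Ureg d k y))]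
      apply lintegral_congr
      intro u
      change (packSet d (k + 1) S).indicator _
        (i.insertNth u y : Fin (k + 1) → EuclideanSpace ℝ (Fin d)) = _
      simp only [Set.indicator, insertNth_mem_packSet, hG, hy, true_and]
    · rw [Set.indicator_of_notMem hy]
      rw [lintegral_eq_zero_of_ae_eq_zero]
      refine Filter.Eventually.of_forall fun u => ?_
      change (packSet d (k + 1) S).indicator _
        (i.insertNth u y : Fin (k + 1) → EuclideanSpace ℝ (Fin d)) = 0
      simp only [Set.indicator, insertNth_mem_packSet, hy, false_and, if_false]
  · exact ((hF.indicator (measurableSet_packSet d _ hS)).comp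
      (MeasurableEquiv.measurable _)).aemeasurable

lemma mecke (d : ℕ) {S : Set (EuclideanSpace ℝ (Fin d))} (hS : MeasurableSet S) (l : ℝ≥0∞)
    (F : ∀ k : ℕ, (Fin k → EuclideanSpace ℝ (Fin d)) → Fin k → ℝ≥0∞)
    (hF : ∀ k i, Measurable fun x => F k x i)
    (G : ∀ k : ℕ, EuclideanSpace ℝ (Fin d) → (Fin k → EuclideanSpace ℝ (Fin d)) → ℝ≥0∞)
    (hG : ∀ k i u y,
      F (k + 1) (i.insertNth u y : Fin (k + 1) → EuclideanSpace ℝ (Fin d)) i = G k u y) :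
    Eint d S l (fun k x => ∑ i, F k x i) =
      l * Eint d S l (fun k y => ∫⁻ u in S ∩ Ureg d y, G k u y) := by
  unfold Eint
  rw [tsum_eq_zero_add' ENNReal.summable, ← ENNReal.tsum_mul_left]
  simp only [Finset.univ_eq_empty, Finset.sum_empty, lintegral_zero, mul_zero, zero_add]
  refine tsum_congr fun k => ?_
  rw [lintegral_finsetSum _ fun i _ => hF (k + 1) i]
  rw [Finset.sum_congr rfl fun i _ => mecke_one d k hS i _ (hF (k+1) i) (G k) (hG k i)]
  rw [Finset.sum_const, Finset.card_univ, Fintype.card_fin, nsmul_eq_mul, ← mul_assoc, ← mul_assoc]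
  congr 1
  rw [Nat.factorial_succ, pow_succ, Nat.cast_mul, ENNReal.div_eq_inv_mul, ENNReal.div_eq_inv_mul,
    ENNReal.mul_inv (by simp) (by simp)]
  have : ((k + 1 : ℕ) : ℝ≥0∞)⁻¹ * ((k + 1 : ℕ) : ℝ≥0∞) = 1 :=
    ENNReal.inv_mul_cancel (by simp) (by simp)
  calc _ = (((k + 1 : ℕ) : ℝ≥0∞)⁻¹ * ((k + 1 : ℕ) : ℝ≥0∞)) *
        (l * (((Nat.factorial k : ℕ) : ℝ≥0∞)⁻¹ * l ^ k)) := by ring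
    _ = _ := by rw [this, one_mul]

lemma Eint_mono (d : ℕ) (S : Set (EuclideanSpace ℝ (Fin d))) (l : ℝ≥0∞)
    {F G : ∀ k : ℕ, (Fin k → EuclideanSpace ℝ (Fin d)) → ℝ≥0∞} (h : ∀ k x, F k x ≤ G k x) :
    Eint d S l F ≤ Eint d S l G :=
  ENNReal.tsum_le_tsum fun k => by gcongr; exact h _ _

lemma Eint_add (d : ℕ) (S : Set (EuclideanSpace ℝ (Fin d))) (l : ℝ≥0∞)
    (F G : ∀ k : ℕ, (Fin k → EuclideanSpace ℝ (Fin d)) → ℝ≥0∞) (hF : ∀ k, Measurable (F k)) :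
    Eint d S l (fun k x => F k x + G k x) = Eint d S l F + Eint d S l G := by
  unfold Eint
  rw [← ENNReal.tsum_add]
  refine tsum_congr fun k => ?_
  rw [lintegral_add_left (hF k), mul_add]

lemma Eint_const_mul (d : ℕ) (S : Set (EuclideanSpace ℝ (Fin d))) (l : ℝ≥0∞) {c : ℝ≥0∞}
    (hc : c ≠ ⊤) (F : ∀ k : ℕ, (Fin k → EuclideanSpace ℝ (Fin d)) → ℝ≥0∞) :
    Eint d S l (fun k x => c * F k x) = c * Eint d S l F := by
  unfold Eint
  rw [← ENNReal.tsum_mul_left]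
  refine tsum_congr fun k => ?_
  rw [lintegral_const_mul' _ _ hc]
  ring

lemma Eint_tsum (d : ℕ) (S : Set (EuclideanSpace ℝ (Fin d))) (l : ℝ≥0∞)
    (F : ℕ → ∀ k : ℕ, (Fin k → EuclideanSpace ℝ (Fin d)) → ℝ≥0∞)
    (hF : ∀ m k, Measurable (F m k)) :
    Eint d S l (fun k x => ∑' m, F m k x) = ∑' m, Eint d S l (F m) := by
  unfold Eint
  rw [ENNReal.tsum_comm]
  refine tsum_congr fun k => ?_
  rw [lintegral_tsum fun m => (hF m k).aemeasurable, ENNReal.tsum_mul_left]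

lemma Eint_measurable (d : ℕ) (S : Set (EuclideanSpace ℝ (Fin d))) (l : ℝ≥0∞)
    (F : EuclideanSpace ℝ (Fin d) → ∀ k : ℕ, (Fin k → EuclideanSpace ℝ (Fin d)) → ℝ≥0∞)
    (hF : ∀ k, Measurable fun p : EuclideanSpace ℝ (Fin d) × (Fin k → EuclideanSpace ℝ (Fin d)) =>
      F p.1 k p.2) :
    Measurable fun v => Eint d S l (F v) := by
  unfold Eint
  refine Measurable.tsum fun k => ?_
  exact (Measurable.lintegral_prod_right' (hF k)).const_mul _

lemma Eint_swap (d : ℕ) (S : Set (EuclideanSpace ℝ (Fin d))) (l : ℝ≥0∞)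
    (F : EuclideanSpace ℝ (Fin d) → ∀ k : ℕ, (Fin k → EuclideanSpace ℝ (Fin d)) → ℝ≥0∞)
    (hF : ∀ k, Measurable fun p : EuclideanSpace ℝ (Fin d) × (Fin k → EuclideanSpace ℝ (Fin d)) =>
      F p.1 k p.2) :
    ∫⁻ v in S, Eint d S l (F v) = Eint d S l (fun k x => ∫⁻ v in S, F v k x) := by
  unfold Eint
  rw [lintegral_tsum]
  · refine tsum_congr fun k => ?_
    rw [lintegral_const_mul _ (Measurable.lintegral_prod_right' (hF k))]
    congr 1
    exact lintegral_lintegral_swap (hF k).aemeasurable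
  · intro k
    exact ((Measurable.lintegral_prod_right' (hF k)).const_mul _).aemeasurable

/-- Number of points of the configuration within `2 r_d` of `v`. -/
noncomputable def NN (d : ℕ) (v : EuclideanSpace ℝ (Fin d)) {k : ℕ}
    (x : Fin k → EuclideanSpace ℝ (Fin d)) : ℕ :=
  ∑ i, if dist (x i) v ≤ 2 * rd d then 1 else 0

/-- Volume of the externally uncovered region. -/
noncomputable def tau (d : ℕ) (S : Set (EuclideanSpace ℝ (Fin d)))
    (v : EuclideanSpace ℝ (Fin d)) {k : ℕ} (x : Fin k → EuclideanSpace ℝ (Fin d)) : ℝ≥0∞ :=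
  volume (Treg d S v x)

/-- Indicator of the ball. -/
noncomputable def bI (d : ℕ) (v u : EuclideanSpace ℝ (Fin d)) : ℝ≥0∞ :=
  if dist u v ≤ 2 * rd d then 1 else 0

lemma bI_measurable (d : ℕ) :
    Measurable fun p : EuclideanSpace ℝ (Fin d) × EuclideanSpace ℝ (Fin d) => bI d p.1 p.2 := by
  unfold bI
  exact Measurable.ite (measurableSet_le (measurable_snd.dist measurable_fst) measurable_const)
    measurable_const measurable_const

lemma bI_measurable_right (d : ℕ) (v : EuclideanSpace ℝ (Fin d)) :
    Measurable fun u => bI d v u := by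
  unfold bI
  exact Measurable.ite (measurableSet_le (measurable_id.dist measurable_const) measurable_const)
    measurable_const measurable_const

lemma NN_measurable (d k : ℕ) :
    Measurable fun p : EuclideanSpace ℝ (Fin d) × (Fin k → EuclideanSpace ℝ (Fin d)) =>
      NN d p.1 p.2 := by
  unfold NN
  refine Finset.measurable_fun_sum _ fun i _ => ?_
  exact Measurable.ite (measurableSet_le
    (((measurable_pi_apply i).comp measurable_snd).dist measurable_fst) measurable_const)
    measurable_const measurable_const

lemma meas_mk (d k : ℕ) (v : EuclideanSpace ℝ (Fin d)) :
    Measurable fun x : Fin k → EuclideanSpace ℝ (Fin d) => (v, x) := measurable_prodMk_left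

lemma NN_measurable_right (d k : ℕ) (v : EuclideanSpace ℝ (Fin d)) :
    Measurable fun x : Fin k → EuclideanSpace ℝ (Fin d) => NN d v x := by
  have := (NN_measurable d k).comp (meas_mk d k v)
  exact this

lemma measurableSet_Treg_prod (d k : ℕ) {S : Set (EuclideanSpace ℝ (Fin d))}
    (hS : MeasurableSet S) :
    MeasurableSet {p : (EuclideanSpace ℝ (Fin d) × (Fin k → EuclideanSpace ℝ (Fin d))) ×
      EuclideanSpace ℝ (Fin d) | p.2 ∈ Treg d S p.1.1 p.1.2} := by
  have : {p : (EuclideanSpace ℝ (Fin d) × (Fin k → EuclideanSpace ℝ (Fin d))) ×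
      EuclideanSpace ℝ (Fin d) | p.2 ∈ Treg d S p.1.1 p.1.2} =
      ({p | dist p.2 p.1.1 ≤ 2 * rd d} ∩ {p | p.2 ∈ S}) ∩
        ⋂ i, ({p | dist (p.1.2 i) p.1.1 ≤ 2 * rd d} ∪ {p | 2 * rd d < dist p.2 (p.1.2 i)}) := by
    ext p
    simp only [Treg, Set.mem_ofPred_eq, Set.mem_inter_iff, Set.mem_iInter, Set.mem_union,
      Metric.mem_closedBall, gt_iff_lt, ← not_lt, imp_iff_not_or]
  rw [this]
  refine ((measurableSet_le (measurable_snd.dist measurable_fst.fst) measurable_const).inter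
    (measurable_snd hS)).inter (MeasurableSet.iInter fun i => ?_)
  have hi : Measurable fun p : (EuclideanSpace ℝ (Fin d) × (Fin k → EuclideanSpace ℝ (Fin d))) ×
      EuclideanSpace ℝ (Fin d) => p.1.2 i := (measurable_pi_apply i).comp measurable_fst.snd
  exact (measurableSet_le (hi.dist measurable_fst.fst) measurable_const).union
    (measurableSet_lt measurable_const (measurable_snd.dist hi))

lemma measurableSet_Treg (d k : ℕ) {S : Set (EuclideanSpace ℝ (Fin d))}
    (hS : MeasurableSet S) (v : EuclideanSpace ℝ (Fin d))
    (x : Fin k → EuclideanSpace ℝ (Fin d)) : MeasurableSet (Treg d S v x) :=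
  (measurable_const (a := (v, x))).prodMk measurable_id (measurableSet_Treg_prod d k hS)

lemma tau_measurable (d k : ℕ) {S : Set (EuclideanSpace ℝ (Fin d))} (hS : MeasurableSet S) :
    Measurable fun p : EuclideanSpace ℝ (Fin d) × (Fin k → EuclideanSpace ℝ (Fin d)) =>
      tau d S p.1 p.2 :=
  measurable_measure_prodMk_left (measurableSet_Treg_prod d k hS)

lemma tau_measurable_right (d k : ℕ) {S : Set (EuclideanSpace ℝ (Fin d))} (hS : MeasurableSet S)
    (v : EuclideanSpace ℝ (Fin d)) :
    Measurable fun x : Fin k → EuclideanSpace ℝ (Fin d) => tau d S v x := by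
  have := (tau_measurable d k hS).comp (meas_mk d k v)
  exact this

lemma NN_insertNth (d k : ℕ) (v u : EuclideanSpace ℝ (Fin d)) (i : Fin (k + 1))
    (y : Fin k → EuclideanSpace ℝ (Fin d)) (hu : dist u v ≤ 2 * rd d) :
    NN d v (i.insertNth u y : Fin (k + 1) → EuclideanSpace ℝ (Fin d)) = NN d v y + 1 := by
  unfold NN
  rw [Fin.sum_univ_succAbove _ i]
  simp [hu, add_comm]

lemma Treg_insertNth (d k : ℕ) (S : Set (EuclideanSpace ℝ (Fin d)))
    (v u : EuclideanSpace ℝ (Fin d)) (i : Fin (k + 1))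
    (y : Fin k → EuclideanSpace ℝ (Fin d)) (hu : dist u v ≤ 2 * rd d) :
    Treg d S v (i.insertNth u y : Fin (k + 1) → EuclideanSpace ℝ (Fin d)) = Treg d S v y := by
  unfold Treg
  ext p
  simp only [Set.mem_ofPred_eq]
  rw [Fin.forall_iff_succAbove i]
  simp [not_lt.mpr hu]

lemma Ureg_inter_subset (d k : ℕ) (S : Set (EuclideanSpace ℝ (Fin d)))
    (v : EuclideanSpace ℝ (Fin d)) (y : Fin k → EuclideanSpace ℝ (Fin d)) :
    (S ∩ Ureg d y) ∩ Metric.closedBall v (2 * rd d) ⊆ Treg d S v y := by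
  rintro p ⟨⟨h1, h2⟩, h3⟩
  exact ⟨⟨h3, h1⟩, fun i _ => h2 i⟩

lemma lintegral_bI_mul (d : ℕ) {A : Set (EuclideanSpace ℝ (Fin d))}
    (v : EuclideanSpace ℝ (Fin d)) (f : EuclideanSpace ℝ (Fin d) → ℝ≥0∞) :
    ∫⁻ u in A, bI d v u * f u = ∫⁻ u in A ∩ Metric.closedBall v (2 * rd d), f u := by
  have : ∀ u, bI d v u * f u = (Metric.closedBall v (2 * rd d)).indicator f u := by
    intro u
    simp only [bI, Set.indicator, Metric.mem_closedBall]
    split_ifs <;> simp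
  simp_rw [this]
  rw [lintegral_indicator Metric.isClosed_closedBall.measurableSet,
    Measure.restrict_restrict Metric.isClosed_closedBall.measurableSet, Set.inter_comm]

lemma sum_bI (d k : ℕ) (v : EuclideanSpace ℝ (Fin d)) (x : Fin k → EuclideanSpace ℝ (Fin d)) :
    ∑ i, bI d v (x i) = (NN d v x : ℝ≥0∞) := by
  unfold NN bI
  push_cast
  rfl

/-- One-step removal. -/
lemma step (d : ℕ) {S : Set (EuclideanSpace ℝ (Fin d))} (hS : MeasurableSet S) (l : ℝ≥0∞)
    (v : EuclideanSpace ℝ (Fin d)) (h : ℝ≥0∞ → ℝ≥0∞) (hh : Measurable h) (m : ℕ) :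
    ((m + 1 : ℕ) : ℝ≥0∞) * Eint d S l (fun k x => if NN d v x = m + 1 then h (tau d S v x) else 0) ≤
      l * Eint d S l (fun k x => if NN d v x = m then h (tau d S v x) * tau d S v x else 0) := by
  have key := mecke d hS l
    (fun k x i => bI d v (x i) * if NN d v x = m + 1 then h (tau d S v x) else 0)
    (by
      intro k i
      refine ((bI_measurable_right d v).comp (measurable_pi_apply i)).mul ?_
      exact Measurable.ite ((NN_measurable_right d k v) (measurableSet_singleton _))
        (hh.comp (tau_measurable_right d k hS v)) measurable_const)
    (fun k u y => bI d v u * if NN d v y = m then h (tau d S v y) else 0)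
    (by
      intro k i u y
      simp only [Fin.insertNth_apply_same]
      by_cases hu : dist u v ≤ 2 * rd d
      · simp only [NN_insertNth d k v u i y hu, tau, Treg_insertNth d k S v u i y hu,
          Nat.add_right_cancel_iff]
      · simp [bI, hu])
  calc _ = Eint d S l (fun k x => ∑ i, bI d v (x i) *
        if NN d v x = m + 1 then h (tau d S v x) else 0) := by
        rw [← Eint_const_mul _ _ _ (by simp)]
        congr 1
        funext k x
        rw [← Finset.sum_mul, sum_bI]
        split_ifs with h1
        · rw [h1]
        · simp
    _ = _ := key
    _ ≤ _ := by
        gcongr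
        refine Eint_mono _ _ _ fun k y => ?_
        rw [lintegral_bI_mul, lintegral_const, Measure.restrict_apply_univ]
        split_ifs with h1
        · gcongr
          exact measure_mono (Ureg_inter_subset d k S v y)
        · simp

lemma steps (d : ℕ) {S : Set (EuclideanSpace ℝ (Fin d))} (hS : MeasurableSet S) (l : ℝ≥0∞)
    (hl : l ≠ ⊤) (v : EuclideanSpace ℝ (Fin d)) (m : ℕ) : ∀ (h : ℝ≥0∞ → ℝ≥0∞), Measurable h →
    Eint d S l (fun k x => if NN d v x = m then h (tau d S v x) else 0) ≤
      Eint d S l (fun k x => if NN d v x = 0 then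
        h (tau d S v x) * ((l * tau d S v x) ^ m / (Nat.factorial m : ℝ≥0∞)) else 0) := by
  induction m with
  | zero => intro h hh; simp
  | succ m ih =>
    intro h hh
    have h1 := step d hS l v h hh m
    have h2 := ih (fun t => h t * t) (hh.mul measurable_id)
    have h0 : ((m + 1 : ℕ) : ℝ≥0∞) ≠ 0 := by simp
    have hm1 : ((m + 1 : ℕ) : ℝ≥0∞)⁻¹ * ((m + 1 : ℕ) : ℝ≥0∞) = 1 :=
      ENNReal.inv_mul_cancel (by simp) (by simp)
    calc Eint d S l (fun k x => if NN d v x = m + 1 then h (tau d S v x) else 0)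
        = ((m + 1 : ℕ) : ℝ≥0∞)⁻¹ * (((m + 1 : ℕ) : ℝ≥0∞) *
          Eint d S l (fun k x => if NN d v x = m + 1 then h (tau d S v x) else 0)) := by
          rw [← mul_assoc, hm1, one_mul]
      _ ≤ ((m + 1 : ℕ) : ℝ≥0∞)⁻¹ * (l * Eint d S l (fun k x => if NN d v x = 0 then
        (h (tau d S v x) * tau d S v x) *
          ((l * tau d S v x) ^ m / (Nat.factorial m : ℝ≥0∞)) else 0)) := by
          exact mul_le_mul_right (h1.trans (mul_le_mul_right h2 _)) _
      _ = _ := by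
          rw [← mul_assoc, ← Eint_const_mul _ _ _
            (ENNReal.mul_ne_top (ENNReal.inv_ne_top.mpr h0) hl)]
          congr 1
          funext k x
          split_ifs
          · rw [Nat.factorial_succ, pow_succ, Nat.cast_mul, ENNReal.div_eq_inv_mul,
              ENNReal.div_eq_inv_mul, ENNReal.mul_inv (by simp) (by simp)]
            ring
          · simp

lemma NN_eq_zero (d k : ℕ) (v : EuclideanSpace ℝ (Fin d))
    (x : Fin k → EuclideanSpace ℝ (Fin d)) : NN d v x = 0 ↔ v ∈ Ureg d x := by
  simp [NN, Ureg, dist_comm]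

lemma tsum_exp_le (t : ℝ) (ht : 0 ≤ t) :
    ENNReal.ofReal (Real.exp (-t)) *
      ∑' m : ℕ, (ENNReal.ofReal t) ^ m / (Nat.factorial m : ℝ≥0∞) = 1 := by
  have : ∀ m : ℕ, (ENNReal.ofReal t) ^ m / (Nat.factorial m : ℝ≥0∞) =
      ENNReal.ofReal (t ^ m / (Nat.factorial m : ℝ)) := by
    intro m
    rw [ENNReal.ofReal_div_of_pos (by positivity), ENNReal.ofReal_pow ht, ENNReal.ofReal_natCast]
  simp_rw [this]
  rw [← ENNReal.ofReal_tsum_of_nonneg (fun n => by positivity) (Real.summable_pow_div_factorial t),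
    ← ENNReal.ofReal_mul (Real.exp_nonneg _), ← congrFun (NormedSpace.exp_eq_tsum_div (𝔸 := ℝ)) t,
    ← Real.exp_eq_exp_ℝ, ← Real.exp_add]
  simp

lemma void_bound (d : ℕ) {S : Set (EuclideanSpace ℝ (Fin d))} (hS : MeasurableSet S) (lam : ℝ)
    (hl : 0 ≤ lam) (v : EuclideanSpace ℝ (Fin d)) :
    Eint d S (ENNReal.ofReal lam) (fun k x =>
      ENNReal.ofReal (Real.exp (-(lam * (tau d S v x).toReal)))) ≤
    Eint d S (ENNReal.ofReal lam) (fun k x => if NN d v x = 0 then 1 else 0) := by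
  set h : ℝ≥0∞ → ℝ≥0∞ := fun t => ENNReal.ofReal (Real.exp (-(lam * t.toReal))) with hh
  have hm : Measurable h := by
    rw [hh]; fun_prop
  set l := ENNReal.ofReal lam with hl'
  have htau : ∀ k (x : Fin k → EuclideanSpace ℝ (Fin d)), tau d S v x ≠ ⊤ := by
    intro k x
    refine ne_top_of_le_ne_top ?_ (measure_mono (fun p hp => hp.1.1))
    exact (isCompact_closedBall v (2 * rd d)).measure_lt_top.ne
  calc Eint d S l (fun k x => h (tau d S v x))
      = Eint d S l (fun k x => ∑' m, if NN d v x = m then h (tau d S v x) else 0) := by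
        congr 1
        funext k x
        simp only [eq_comm (a := NN d v x)]
        rw [tsum_ite_eq]
    _ = ∑' m, Eint d S l (fun k x => if NN d v x = m then h (tau d S v x) else 0) := by
        apply Eint_tsum
        intro m k
        exact Measurable.ite ((NN_measurable_right d k v) (measurableSet_singleton _))
          (hm.comp (tau_measurable_right d k hS v)) measurable_const
    _ ≤ ∑' m, Eint d S l (fun k x => if NN d v x = 0 then
        h (tau d S v x) * ((l * tau d S v x) ^ m / (Nat.factorial m : ℝ≥0∞)) else 0) :=
        ENNReal.tsum_le_tsum fun m => steps d hS l ENNReal.ofReal_ne_top v m h hm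
    _ = Eint d S l (fun k x => ∑' m, if NN d v x = 0 then
        h (tau d S v x) * ((l * tau d S v x) ^ m / (Nat.factorial m : ℝ≥0∞)) else 0) := by
        symm
        apply Eint_tsum
        intro m k
        exact Measurable.ite ((NN_measurable_right d k v) (measurableSet_singleton _))
          ((hm.comp (tau_measurable_right d k hS v)).mul
            ((((tau_measurable_right d k hS v).const_mul l).pow_const m).div_const _))
            measurable_const
    _ ≤ _ := by
        refine Eint_mono _ _ _ fun k x => ?_
        split_ifs
        · rw [ENNReal.tsum_mul_left]
          have e : l * tau d S v x = ENNReal.ofReal (lam * (tau d S v x).toReal) := by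
            rw [ENNReal.ofReal_mul hl, ENNReal.ofReal_toReal (htau k x)]
          rw [e]
          exact (tsum_exp_le _ (by positivity)).le
        · simp

lemma rd_pos (d : ℕ) : 0 < rd d := by
  unfold rd
  apply Real.rpow_pos_of_pos
  refine ENNReal.toReal_pos ?_ ?_
  · exact (Metric.measure_closedBall_pos volume _ one_pos).ne'
  · exact (isCompact_closedBall _ _).measure_lt_top.ne

lemma volume_ball_rd (d : ℕ) (hd : 1 ≤ d) (x : EuclideanSpace ℝ (Fin d)) (a : ℝ) (ha : 0 ≤ a) :
    volume (Metric.closedBall x (a * rd d)) = ENNReal.ofReal (a ^ d) := by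
  have h1 : volume (Metric.closedBall (0 : EuclideanSpace ℝ (Fin d)) 1) ≠ ⊤ :=
    (isCompact_closedBall _ _).measure_lt_top.ne
  have h0 : 0 < (volume (Metric.closedBall (0 : EuclideanSpace ℝ (Fin d)) 1)).toReal :=
    ENNReal.toReal_pos (Metric.measure_closedBall_pos volume _ one_pos).ne' h1
  have h2 := Measure.addHaar_closedBall_mul volume x (r := a * rd d) (s := 1)
    (mul_nonneg ha (rd_pos d).le) zero_le_one
  rw [mul_one] at h2
  rw [h2, finrank_euclideanSpace_fin]
  have hd0 : (d : ℝ) ≠ 0 := by positivity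
  have h3 : rd d ^ d = (volume (Metric.closedBall (0 : EuclideanSpace ℝ (Fin d)) 1)).toReal⁻¹ := by
    unfold rd
    rw [← Real.rpow_natCast, ← Real.rpow_mul h0.le]
    rw [div_mul_cancel₀ _ hd0, Real.rpow_neg_one]
  nth_rewrite 1 [← ENNReal.ofReal_toReal h1]
  rw [← ENNReal.ofReal_mul (pow_nonneg (mul_nonneg ha (rd_pos d).le) _), mul_pow, h3]
  congr 1
  field_simp

lemma volume_ball_two (d : ℕ) (hd : 1 ≤ d) (x : EuclideanSpace ℝ (Fin d)) :
    volume (Metric.closedBall x (2 * rd d)) = 2 ^ d := by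
  rw [volume_ball_rd d hd x 2 (by norm_num), ENNReal.ofReal_pow (by norm_num)]
  simp

lemma geom_point (d : ℕ) (v p q : EuclideanSpace ℝ (Fin d)) (hp : dist p v ≤ 2 * rd d)
    (hq : dist q p ≤ 2 * rd d) (hqp : dist q v ≤ dist p v) :
    dist q (midpoint ℝ p v) ≤ √3 * rd d := by
  have hr := rd_pos d
  have key := EuclideanGeometry.dist_sq_add_dist_sq_eq_two_mul_dist_midpoint_sq_add_half_dist_sq
    q p v
  have h3 : (√3 * rd d) ^ 2 = 3 * rd d ^ 2 := by
    rw [mul_pow, Real.sq_sqrt (by norm_num)]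
  refine le_of_sq_le_sq ?_ (by positivity)
  rw [h3]
  have a1 : dist q p ^ 2 ≤ (2 * rd d) ^ 2 := by gcongr
  have a2 : dist q v ^ 2 ≤ dist p v ^ 2 := by gcongr
  have a3 : dist p v ^ 2 ≤ (2 * rd d) ^ 2 := by gcongr
  nlinarith

/-- Ordered pairs indicator. -/
noncomputable def oI (d : ℕ) (v p q : EuclideanSpace ℝ (Fin d)) : ℝ≥0∞ :=
  if dist q p ≤ 2 * rd d ∧ dist q v ≤ dist p v then 1 else 0

lemma oI_measurable (d : ℕ) (v : EuclideanSpace ℝ (Fin d)) :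
    Measurable fun p : EuclideanSpace ℝ (Fin d) × EuclideanSpace ℝ (Fin d) => oI d v p.1 p.2 := by
  unfold oI
  refine Measurable.ite (MeasurableSet.inter
    (measurableSet_le (measurable_snd.dist measurable_fst) measurable_const)
    (measurableSet_le (measurable_snd.dist measurable_const) (measurable_fst.dist measurable_const)))
    measurable_const measurable_const

lemma oI_measurable_right (d : ℕ) (v p : EuclideanSpace ℝ (Fin d)) :
    Measurable fun q => oI d v p q := by
  unfold oI
  refine Measurable.ite (MeasurableSet.inter
    (measurableSet_le (measurable_id.dist measurable_const) measurable_const)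
    (measurableSet_le (measurable_id.dist measurable_const) measurable_const))
    measurable_const measurable_const

lemma geom (d : ℕ) (hd : 1 ≤ d) (v : EuclideanSpace ℝ (Fin d))
    (T : Set (EuclideanSpace ℝ (Fin d))) (hT : MeasurableSet T)
    (hTv : T ⊆ Metric.closedBall v (2 * rd d)) :
    ∫⁻ u in T, volume (T ∩ Metric.closedBall u (2 * rd d)) ≤
      ENNReal.ofReal (2 * √3 ^ d) * volume T := by
  have hb : ∀ p q, bI d p q ≤ oI d v p q + oI d v q p := by
    intro p q
    unfold bI oI
    rw [dist_comm p q]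
    rcases le_total (dist q v) (dist p v) with h | h <;> by_cases h2 : dist q p ≤ 2 * rd d <;>
      simp [h, h2]
  have h1 : ∀ p, volume (T ∩ Metric.closedBall p (2 * rd d)) = ∫⁻ q in T, bI d p q := by
    intro p
    have := lintegral_bI_mul d (A := T) p (fun _ => 1)
    simp only [mul_one, lintegral_one, Measure.restrict_apply_univ] at this
    exact this.symm
  have h2 : ∫⁻ p in T, ∫⁻ q in T, oI d v p q ≤ ENNReal.ofReal (√3 ^ d) * volume T := by
    rw [← setLIntegral_const]
    refine setLIntegral_mono measurable_const fun p hp => ?_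
    calc ∫⁻ q in T, oI d v p q ≤ ∫⁻ q, oI d v p q := setLIntegral_le_lintegral _ _
      _ ≤ ∫⁻ q, (Metric.closedBall (midpoint ℝ p v) (√3 * rd d)).indicator 1 q := by
          refine lintegral_mono fun q => ?_
          unfold oI
          split_ifs with h
          · rw [Set.indicator_of_mem]
            · simp
            · exact geom_point d v p q (hTv hp) h.1 h.2
          · simp
      _ = _ := by
          rw [lintegral_indicator_one Metric.isClosed_closedBall.measurableSet,
            volume_ball_rd d hd _ _ (by positivity)]
  have h3 : ∫⁻ p in T, ∫⁻ q in T, oI d v q p = ∫⁻ p in T, ∫⁻ q in T, oI d v p q :=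
    lintegral_lintegral_swap ((oI_measurable d v).comp measurable_swap).aemeasurable
  simp_rw [h1]
  calc ∫⁻ p in T, ∫⁻ q in T, bI d p q
      ≤ ∫⁻ p in T, ∫⁻ q in T, (oI d v p q + oI d v q p) :=
        lintegral_mono fun p => lintegral_mono fun q => hb p q
    _ = ∫⁻ p in T, ((∫⁻ q in T, oI d v p q) + ∫⁻ q in T, oI d v q p) := by
        refine lintegral_congr fun p => ?_
        rw [lintegral_add_left]
        exact oI_measurable_right d v p
    _ = (∫⁻ p in T, ∫⁻ q in T, oI d v p q) + ∫⁻ p in T, ∫⁻ q in T, oI d v q p := by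
        rw [lintegral_add_left]
        exact Measurable.lintegral_prod_right' (oI_measurable d v)
    _ ≤ _ := by
        rw [h3, ENNReal.ofReal_mul (by norm_num), ENNReal.ofReal_ofNat]
        calc _ ≤ ENNReal.ofReal (√3 ^ d) * volume T + ENNReal.ofReal (√3 ^ d) * volume T :=
              add_le_add h2 h2
          _ = _ := by ring

lemma tau_le (d : ℕ) {S : Set (EuclideanSpace ℝ (Fin d))}
    (v : EuclideanSpace ℝ (Fin d)) (k : ℕ) (x : Fin k → EuclideanSpace ℝ (Fin d)) :
    tau d S v x ≤ volume ((S ∩ Ureg d x) ∩ Metric.closedBall v (2 * rd d)) +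
      ∑ i, bI d v (x i) * volume (Treg d S v x ∩ Metric.closedBall (x i) (2 * rd d)) := by
  classical
  have hsub : Treg d S v x ⊆ ((S ∩ Ureg d x) ∩ Metric.closedBall v (2 * rd d)) ∪
      ⋃ i ∈ Finset.univ.filter (fun i => dist (x i) v ≤ 2 * rd d),
        (Treg d S v x ∩ Metric.closedBall (x i) (2 * rd d)) := by
    intro p hp
    by_cases hU : p ∈ Ureg d x
    · exact Or.inl ⟨⟨hp.1.2, hU⟩, hp.1.1⟩
    · right
      simp only [Ureg, Set.mem_ofPred_eq, not_forall, not_lt, gt_iff_lt] at hU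
      obtain ⟨i, hi⟩ := hU
      have : dist (x i) v ≤ 2 * rd d := by
        by_contra hc
        exact absurd (hp.2 i (not_le.mp hc)) (not_lt.mpr hi)
      simp only [Set.mem_iUnion]
      exact ⟨i, by simp [this], hp, hi⟩
  refine (measure_mono hsub).trans ((measure_union_le _ _).trans ?_)
  gcongr
  refine (measure_biUnion_finset_le _ _).trans ?_
  rw [Finset.sum_filter]
  refine Finset.sum_le_sum fun i _ => ?_
  unfold bI
  split_ifs <;> simp

lemma meas_TB (d k : ℕ) {S : Set (EuclideanSpace ℝ (Fin d))} (hS : MeasurableSet S)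
    (v : EuclideanSpace ℝ (Fin d)) (i : Fin k) :
    Measurable fun x : Fin k → EuclideanSpace ℝ (Fin d) =>
      volume (Treg d S v x ∩ Metric.closedBall (x i) (2 * rd d)) := by
  have h1 : MeasurableSet {p : (Fin k → EuclideanSpace ℝ (Fin d)) × EuclideanSpace ℝ (Fin d) |
      p.2 ∈ Treg d S v p.1} := by
    have hm : Measurable fun p : (Fin k → EuclideanSpace ℝ (Fin d)) × EuclideanSpace ℝ (Fin d) =>
        ((v, p.1), p.2) := by
      exact ((meas_mk d k v).comp measurable_fst).prodMk measurable_snd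
    have := hm (measurableSet_Treg_prod d k hS)
    exact this
  have hi : Measurable fun p : (Fin k → EuclideanSpace ℝ (Fin d)) × EuclideanSpace ℝ (Fin d) =>
      p.1 i := (measurable_pi_apply i).comp measurable_fst
  have h2 : MeasurableSet {p : (Fin k → EuclideanSpace ℝ (Fin d)) × EuclideanSpace ℝ (Fin d) |
      dist p.2 (p.1 i) ≤ 2 * rd d} := measurableSet_le (measurable_snd.dist hi) measurable_const
  have := measurable_measure_prodMk_left (ν := (volume : Measure (EuclideanSpace ℝ (Fin d))))
    (h1.inter h2)
  exact this

lemma Eint_NN (d : ℕ) {S : Set (EuclideanSpace ℝ (Fin d))} (hS : MeasurableSet S) (l : ℝ≥0∞)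
    (v : EuclideanSpace ℝ (Fin d)) :
    Eint d S l (fun k x => (NN d v x : ℝ≥0∞)) =
      l * Eint d S l (fun k y => volume ((S ∩ Ureg d y) ∩ Metric.closedBall v (2 * rd d))) := by
  have key := mecke d hS l (fun k x i => bI d v (x i))
    (by
      intro k i
      exact (bI_measurable_right d v).comp (measurable_pi_apply i))
    (fun k u y => bI d v u * 1)
    (by
      intro k i u y
      simp only [Fin.insertNth_apply_same, mul_one])
  simp only [sum_bI, lintegral_bI_mul, lintegral_one, Measure.restrict_apply_univ] at key
  exact key

lemma Eint_cover (d : ℕ) (hd : 1 ≤ d) {S : Set (EuclideanSpace ℝ (Fin d))}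
    (hS : MeasurableSet S) (l : ℝ≥0∞) (v : EuclideanSpace ℝ (Fin d)) :
    Eint d S l (fun k x => ∑ i, bI d v (x i) *
        volume (Treg d S v x ∩ Metric.closedBall (x i) (2 * rd d))) ≤
      l * (ENNReal.ofReal (2 * √3 ^ d) * Eint d S l (fun k x => tau d S v x)) := by
  have key := mecke d hS l (fun k x i => bI d v (x i) *
        volume (Treg d S v x ∩ Metric.closedBall (x i) (2 * rd d)))
    (by
      intro k i
      exact ((bI_measurable_right d v).comp (measurable_pi_apply i)).mul
        (meas_TB d k hS v i))
    (fun k u y => bI d v u * volume (Treg d S v y ∩ Metric.closedBall u (2 * rd d)))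
    (by
      intro k i u y
      simp only [Fin.insertNth_apply_same]
      by_cases hu : dist u v ≤ 2 * rd d
      · simp only [Treg_insertNth d k S v u i y hu]
      · simp [bI, hu])
  rw [key, ← Eint_const_mul _ _ _ ENNReal.ofReal_ne_top]
  refine mul_le_mul_right (Eint_mono _ _ _ fun k y => ?_) _
  rw [lintegral_bI_mul]
  refine (lintegral_mono_set (Ureg_inter_subset d k S v y)).trans ?_
  exact geom d hd v _ (measurableSet_Treg d k hS v y) (fun p hp => hp.1.1)

lemma point_D (d : ℕ) (hd : 1 ≤ d) {S : Set (EuclideanSpace ℝ (Fin d))}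
    (hS : MeasurableSet S) (l : ℝ≥0∞) (v : EuclideanSpace ℝ (Fin d)) :
    l * Eint d S l (fun k x => tau d S v x) ≤ Eint d S l (fun k x => (NN d v x : ℝ≥0∞)) +
      l * (l * (ENNReal.ofReal (2 * √3 ^ d) * Eint d S l (fun k x => tau d S v x))) := by
  rw [Eint_NN d hS, ← mul_add]
  refine mul_le_mul_right ?_ _
  refine (Eint_mono _ _ _ (tau_le d v)).trans ?_
  rw [Eint_add]
  · exact add_le_add le_rfl (Eint_cover d hd hS l v)
  · intro k
    have h2 : MeasurableSet {p : (Fin k → EuclideanSpace ℝ (Fin d)) × EuclideanSpace ℝ (Fin d) |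
      dist p.2 v ≤ 2 * rd d} :=
      measurableSet_le (measurable_snd.dist measurable_const) measurable_const
    have := measurable_measure_prodMk_left (ν := (volume : Measure (EuclideanSpace ℝ (Fin d))))
      (((measurable_snd (α := Fin k → EuclideanSpace ℝ (Fin d)) hS).inter
        (measurableSet_Ureg_prod d k)).inter h2)
    exact this

lemma num_eq (d : ℕ) {S : Set (EuclideanSpace ℝ (Fin d))} (hS : MeasurableSet S) (l : ℝ≥0∞) :
    Eint d S l (fun k _ => (k : ℝ≥0∞)) =
      l * ∫⁻ v in S, Eint d S l (fun _ x => if NN d v x = 0 then 1 else 0) := by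
  have key := mecke d hS l (fun _ _ _ => 1) (fun _ _ => measurable_const) (fun _ _ _ => 1)
    (fun _ _ _ _ => rfl)
  simp only [Finset.sum_const, Finset.card_univ, Fintype.card_fin, nsmul_eq_mul, mul_one,
    lintegral_one, Measure.restrict_apply_univ] at key
  rw [key, Eint_swap d S l (fun v _ x => if NN d v x = 0 then 1 else 0)]
  · congr 2
    funext k x
    have : ∀ v, (if NN d v x = 0 then (1 : ℝ≥0∞) else 0) = (Ureg d x).indicator 1 v := by
      intro v
      by_cases h : NN d v x = 0
      · rw [if_pos h, Set.indicator_of_mem ((NN_eq_zero d k v x).mp h), Pi.one_apply]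
      · rw [if_neg h, Set.indicator_of_notMem fun h' => h ((NN_eq_zero d k v x).mpr h')]
    simp_rw [this]
    rw [lintegral_indicator_one (measurableSet_Ureg d k x),
      Measure.restrict_apply (measurableSet_Ureg d k x), Set.inter_comm]
  · intro k
    exact Measurable.ite ((NN_measurable d k) (measurableSet_singleton _))
      measurable_const measurable_const

lemma num_ge (d : ℕ) (hd : 1 ≤ d) (S : Set (EuclideanSpace ℝ (Fin d))) (l : ℝ≥0∞) :
    ∫⁻ v in S, Eint d S l (fun _ x => (NN d v x : ℝ≥0∞)) ≤
      2 ^ d * Eint d S l (fun k _ => (k : ℝ≥0∞)) := by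
  rw [Eint_swap d S l (fun v _ x => (NN d v x : ℝ≥0∞)), ← Eint_const_mul _ _ _ (by finiteness)]
  · refine Eint_mono _ _ _ fun k x => ?_
    simp_rw [← sum_bI]
    have hm : ∀ u, Measurable fun v => bI d v u := by
      intro u
      unfold bI
      exact Measurable.ite (measurableSet_le (measurable_const.dist measurable_id)
        measurable_const) measurable_const measurable_const
    rw [lintegral_finsetSum _ fun i _ => hm (x i)]
    calc ∑ i, ∫⁻ v in S, bI d v (x i) ≤ ∑ i : Fin k, (2 : ℝ≥0∞) ^ d := by
          refine Finset.sum_le_sum fun i _ => ?_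
          refine (setLIntegral_le_lintegral _ _).trans ?_
          have : ∀ v, bI d v (x i) = (Metric.closedBall (x i) (2 * rd d)).indicator 1 v := by
            intro v
            simp only [bI, Set.indicator, Metric.mem_closedBall, dist_comm, Pi.one_apply]
          simp_rw [this]
          rw [lintegral_indicator_one Metric.isClosed_closedBall.measurableSet,
            volume_ball_two d hd]
      _ = _ := by simp [mul_comm]
  · intro k
    have : Measurable fun n : ℕ => (n : ℝ≥0∞) := measurable_from_top
    exact this.comp (NN_measurable d k)

lemma bound_D (d : ℕ) (hd : 1 ≤ d) {S : Set (EuclideanSpace ℝ (Fin d))}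
    (hS : MeasurableSet S) (l : ℝ≥0∞) (hl : l ≠ ⊤) :
    l * (∫⁻ v in S, Eint d S l (fun _ x => tau d S v x)) ≤
      2 ^ d * Eint d S l (fun k _ => (k : ℝ≥0∞)) +
      l * (l * (ENNReal.ofReal (2 * √3 ^ d) *
        ∫⁻ v in S, Eint d S l (fun _ x => tau d S v x))) := by
  rw [← lintegral_const_mul' _ _ ENNReal.ofReal_ne_top, ← lintegral_const_mul' _ _ hl,
    ← lintegral_const_mul' _ _ hl, ← lintegral_const_mul' _ _ hl]
  refine (lintegral_mono fun v => point_D d hd hS l v).trans ?_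
  rw [lintegral_add_left]
  · exact add_le_add (num_ge d hd S l) le_rfl
  · refine Eint_measurable d S l (fun v _ x => (NN d v x : ℝ≥0∞)) fun k => ?_
    have : Measurable fun n : ℕ => (n : ℝ≥0∞) := measurable_from_top
    exact this.comp (NN_measurable d k)

lemma tau_le_two (d : ℕ) (hd : 1 ≤ d) (S : Set (EuclideanSpace ℝ (Fin d)))
    (v : EuclideanSpace ℝ (Fin d)) (k : ℕ) (x : Fin k → EuclideanSpace ℝ (Fin d)) :
    tau d S v x ≤ 2 ^ d * 1 := by
  rw [mul_one, ← volume_ball_two d hd v]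
  exact measure_mono fun p hp => hp.1.1

lemma bound_C (d : ℕ) (hd : 1 ≤ d) {S : Set (EuclideanSpace ℝ (Fin d))}
    (hS : MeasurableSet S) (lam : ℝ) (hl : 0 ≤ lam) (z : ℝ) :
    ENNReal.ofReal (Real.exp (-z) * (1 + z)) *
        (Eint d S (ENNReal.ofReal lam) (fun _ _ => 1) * volume S) ≤
      (∫⁻ v in S, Eint d S (ENNReal.ofReal lam) (fun _ x => if NN d v x = 0 then 1 else 0)) +
      ENNReal.ofReal (Real.exp (-z) * lam) *
        ∫⁻ v in S, Eint d S (ENNReal.ofReal lam) (fun _ x => tau d S v x) := by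
  set l := ENNReal.ofReal lam with hl'
  rw [← lintegral_const_mul' _ _ ENNReal.ofReal_ne_top, ← setLIntegral_const,
    ← lintegral_const_mul' _ _ ENNReal.ofReal_ne_top, ← lintegral_add_right]
  · refine lintegral_mono fun v => ?_
    refine le_trans ?_ (add_le_add (void_bound d hS lam hl v) le_rfl)
    rw [← Eint_const_mul _ _ _ ENNReal.ofReal_ne_top, ← Eint_const_mul _ _ _ ENNReal.ofReal_ne_top,
      ← Eint_add]
    · refine Eint_mono _ _ _ fun k x => ?_
      have htop : tau d S v x ≠ ⊤ :=
        ne_top_of_le_ne_top (by finiteness) (tau_le_two d hd S v k x)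
      set t := (tau d S v x).toReal with ht
      rw [← ENNReal.ofReal_toReal htop, ← ht, ← ENNReal.ofReal_mul (by positivity),
        ← ENNReal.ofReal_add (by positivity) (by positivity), mul_one]
      apply ENNReal.ofReal_le_ofReal
      have h1 := Real.add_one_le_exp (z - lam * t)
      have h2 : Real.exp (-(lam * t)) = Real.exp (-z) * Real.exp (z - lam * t) := by
        rw [← Real.exp_add]; congr 1; ring
      have h3 := mul_le_mul_of_nonneg_left h1 (Real.exp_nonneg (-z))
      rw [h2]
      linarith
    · intro k
      have : Measurable fun t : ℝ≥0∞ => ENNReal.ofReal (Real.exp (-(lam * t.toReal))) := by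
        fun_prop
      exact this.comp (tau_measurable_right d k hS v)
  · exact (Eint_measurable d S l (fun v _ x => tau d S v x)
      fun k => tau_measurable d k hS).const_mul _

lemma vol_pack_le (d k : ℕ) (S : Set (EuclideanSpace ℝ (Fin d))) :
    volume (packSet d k S) ≤ volume S ^ k := by
  calc volume (packSet d k S) ≤ volume (Set.univ.pi fun _ : Fin k => S) :=
        measure_mono fun x hx i _ => hx.1 i
    _ = _ := by rw [volume_pi_pi]; simp

lemma Eint_one_ne_top (d : ℕ) {S : Set (EuclideanSpace ℝ (Fin d))} (hV : volume S ≠ ⊤)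
    (lam : ℝ) (hl : 0 ≤ lam) : Eint d S (ENNReal.ofReal lam) (fun _ _ => 1) ≠ ⊤ := by
  have h1 := tsum_exp_le (lam * (volume S).toReal) (by positivity)
  have h2 : ∑' m : ℕ, (ENNReal.ofReal (lam * (volume S).toReal)) ^ m /
      (Nat.factorial m : ℝ≥0∞) ≠ ⊤ := by
    intro h
    rw [h, ENNReal.mul_top] at h1
    · exact absurd h1 (by simp)
    · simp [Real.exp_pos]
  refine ne_top_of_le_ne_top h2 (ENNReal.tsum_le_tsum fun k => ?_)
  rw [lintegral_one, Measure.restrict_apply_univ, ENNReal.ofReal_mul hl,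
    ENNReal.ofReal_toReal hV, mul_pow, ENNReal.div_eq_inv_mul, ENNReal.div_eq_inv_mul, mul_assoc]
  gcongr
  exact vol_pack_le d k S

lemma Eint_one_ge (d : ℕ) (S : Set (EuclideanSpace ℝ (Fin d))) (l : ℝ≥0∞) :
    1 ≤ Eint d S l (fun _ _ => 1) := by
  refine le_trans ?_ (ENNReal.le_tsum 0)
  have : packSet d 0 S = Set.univ.pi fun _ : Fin 0 => S := by
    ext x; simp [packSet]
  rw [lintegral_one, Measure.restrict_apply_univ, this, volume_pi_pi]
  simp

lemma Zhat_eq (d : ℕ) {S : Set (EuclideanSpace ℝ (Fin d))} (hS : MeasurableSet S) (k : ℕ) :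
    Zhat d S k = (1 / (Nat.factorial k : ℝ)) * (volume (packSet d k S)).toReal := by
  unfold Zhat
  rw [integral_indicator_const _ (measurableSet_packSet d k hS)]
  simp [Measure.real]

lemma Zgc_eq (d : ℕ) {S : Set (EuclideanSpace ℝ (Fin d))} (hS : MeasurableSet S)
    (hV : volume S ≠ ⊤) (lam : ℝ) (hl : 0 ≤ lam) :
    Zgc d S lam = (Eint d S (ENNReal.ofReal lam) (fun _ _ => 1)).toReal := by
  unfold Zgc Eint
  rw [ENNReal.tsum_toReal_eq]
  · refine tsum_congr fun k => ?_
    rw [Zhat_eq d hS, lintegral_one, Measure.restrict_apply_univ]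
    simp [ENNReal.toReal_mul, ENNReal.toReal_div, ENNReal.toReal_ofReal hl]
    ring
  · exact ENNReal.ne_top_of_tsum_ne_top (Eint_one_ne_top d hV lam hl)

lemma num_conv (d : ℕ) {S : Set (EuclideanSpace ℝ (Fin d))} (hS : MeasurableSet S)
    (lam : ℝ) (hl : 0 ≤ lam)
    (hN : Eint d S (ENNReal.ofReal lam) (fun k _ => (k : ℝ≥0∞)) ≠ ⊤) :
    ∑' k : ℕ, (k : ℝ) * lam ^ k * Zhat d S k =
      (Eint d S (ENNReal.ofReal lam) (fun k _ => (k : ℝ≥0∞))).toReal := by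
  have h := ENNReal.ne_top_of_tsum_ne_top hN
  unfold Eint
  rw [ENNReal.tsum_toReal_eq h]
  · refine tsum_congr fun k => ?_
    rw [Zhat_eq d hS, lintegral_const, Measure.restrict_apply_univ]
    simp [ENNReal.toReal_mul, ENNReal.toReal_div, ENNReal.toReal_ofReal hl]
    ring

/-- The two key lower bounds, in terms of a common parameter. -/
lemma two_bounds (d : ℕ) (hd : 1 ≤ d) {S : Set (EuclideanSpace ℝ (Fin d))}
    (hS : MeasurableSet S) (hV : volume S ≠ ⊤) (hV0 : 0 < volume S) (lam : ℝ) (hl : 0 < lam) :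
    ∃ θ : ℝ, 0 ≤ θ ∧ lam * Real.exp (-θ) ≤ alphaS d S lam ∧
      (1 - lam * (2 * √3 ^ d)) * θ ≤ 2 ^ d * alphaS d S lam := by
  have hZ := Eint_one_ne_top d hV lam hl.le
  have hZ1 := Eint_one_ge d S (ENNReal.ofReal lam)
  have hNeq := num_eq d hS (ENNReal.ofReal lam)
  have hD := bound_D d hd hS (ENNReal.ofReal lam) ENNReal.ofReal_ne_top
  have hC := bound_C d hd hS lam hl.le
  have hP : (∫⁻ v in S, Eint d S (ENNReal.ofReal lam)
      (fun _ x => if NN d v x = 0 then 1 else 0)) ≠ ⊤ := by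
    refine ne_top_of_le_ne_top (ENNReal.mul_ne_top hZ hV) ?_
    rw [← setLIntegral_const]
    refine lintegral_mono fun v => Eint_mono _ _ _ fun k x => ?_
    split_ifs <;> simp
  have hT : (∫⁻ v in S, Eint d S (ENNReal.ofReal lam) (fun _ x => tau d S v x)) ≠ ⊤ := by
    refine ne_top_of_le_ne_top (ENNReal.mul_ne_top (b := volume S)
      (ENNReal.mul_ne_top (a := 2 ^ d) (by finiteness) hZ) hV) ?_
    rw [← Eint_const_mul _ _ _ (by finiteness), ← setLIntegral_const]
    exact lintegral_mono fun v => Eint_mono _ _ _ fun k x => tau_le_two d hd S v k x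
  have hN : Eint d S (ENNReal.ofReal lam) (fun k _ => (k : ℝ≥0∞)) ≠ ⊤ := by
    rw [hNeq]; exact ENNReal.mul_ne_top ENNReal.ofReal_ne_top hP
  have hα : alphaS d S lam = (Eint d S (ENNReal.ofReal lam) (fun k _ => (k : ℝ≥0∞))).toReal /
      ((volume S).toReal * (Eint d S (ENNReal.ofReal lam) (fun _ _ => 1)).toReal) := by
    unfold alphaS
    rw [Zgc_eq d hS hV lam hl.le, num_conv d hS lam hl.le hN]
  generalize Eint d S (ENNReal.ofReal lam) (fun k _ => (k : ℝ≥0∞)) = N at *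
  generalize Eint d S (ENNReal.ofReal lam) (fun _ _ => 1) = Z at *
  generalize (∫⁻ v in S, Eint d S (ENNReal.ofReal lam) (fun _ x => tau d S v x)) = T at *
  generalize (∫⁻ v in S, Eint d S (ENNReal.ofReal lam)
      (fun _ x => if NN d v x = 0 then 1 else 0)) = P at *
  generalize volume S = V at *
  have hVr : 0 < V.toReal := ENNReal.toReal_pos hV0.ne' hV
  have hZr : 0 < Z.toReal := ENNReal.toReal_pos (zero_lt_one.trans_le hZ1).ne' hZ
  have hNr : N.toReal = lam * P.toReal := by
    rw [hNeq, ENNReal.toReal_mul, ENNReal.toReal_ofReal hl.le]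
  have hDr : lam * T.toReal ≤ 2 ^ d * N.toReal + lam * (lam * ((2 * √3 ^ d) * T.toReal)) := by
    have := ENNReal.toReal_mono (by finiteness) hD
    rw [ENNReal.toReal_add (by finiteness) (by finiteness)] at this
    simpa [ENNReal.toReal_mul, ENNReal.toReal_ofReal hl.le] using this
  set θ := lam * T.toReal / (V.toReal * Z.toReal) with hθ
  have hθ0 : 0 ≤ θ := by positivity
  have hθm : θ * (V.toReal * Z.toReal) = lam * T.toReal := by
    rw [hθ]; field_simp
  have hCr : Real.exp (-θ) * (1 + θ) * (Z.toReal * V.toReal) ≤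
      P.toReal + Real.exp (-θ) * lam * T.toReal := by
    have := ENNReal.toReal_mono (by finiteness) (hC θ)
    rw [ENNReal.toReal_add (by finiteness) (by finiteness), ENNReal.toReal_mul,
      ENNReal.toReal_mul, ENNReal.toReal_mul, ENNReal.toReal_ofReal (by positivity),
      ENNReal.toReal_ofReal (by positivity)] at this
    exact this
  refine ⟨θ, hθ0, ?_, ?_⟩
  · rw [hα, le_div_iff₀ (by positivity), hNr, mul_assoc]
    refine mul_le_mul_of_nonneg_left ?_ hl.le
    have : Real.exp (-θ) * lam * T.toReal = Real.exp (-θ) * (θ * (V.toReal * Z.toReal)) := by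
      rw [hθm]; ring
    rw [this] at hCr
    linarith
  · rw [hα, ← mul_div_assoc (2 ^ d : ℝ), le_div_iff₀ (by positivity), mul_assoc, hθm]
    linarith

/-- for `log 3 / 2 < c < log 2` and `λ = e^{-cd}`,
`α_S(λ) ≥ (1 + o_d(1)) (log 2 - c) d 2^{-d}`. -/
theorem alphaS_lower_bound_general_fugacity (c : ℝ)
    (hc1 : Real.log 3 / 2 < c) (hc2 : c < Real.log 2) :
    ∀ ε : ℝ, 0 < ε → ∃ d₀ : ℕ, ∀ d : ℕ, d₀ ≤ d →
      ∀ S : Set (EuclideanSpace ℝ (Fin d)), Bornology.IsBounded S → MeasurableSet S →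
        0 < volume S →
        alphaS d S (Real.exp (-(c * d))) ≥ (1 - ε) * (Real.log 2 - c) * d / 2 ^ d := by
  intro ε hε
  have hL : 0 < Real.log 2 - c := by linarith
  set L := Real.log 2 - c with hLdef
  have hq : Real.exp (-c) * √3 < 1 := by
    have : √3 = Real.exp (Real.log 3 / 2) := by
      rw [Real.exp_half, Real.exp_log (by norm_num)]
    rw [this, ← Real.exp_add, Real.exp_lt_one_iff]
    linarith
  have hlim := tendsto_pow_atTop_nhds_zero_of_lt_one (by positivity) hq
  obtain ⟨d1, hd1⟩ := Filter.eventually_atTop.mp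
    (hlim.eventually (gt_mem_nhds (show 0 < ε / 4 by positivity)))
  obtain ⟨d2, hd2⟩ := exists_nat_ge (8 / (ε ^ 2 * L))
  refine ⟨max 1 (max d1 d2), fun d hd S hSb hS hV0 => ?_⟩
  have h1d : 1 ≤ d := (le_max_left _ _).trans hd
  have hdd1 : d1 ≤ d := (le_max_left _ _).trans ((le_max_right _ _).trans hd)
  have hdd2 : d2 ≤ d := (le_max_right _ _).trans ((le_max_right _ _).trans hd)
  have hV : volume S ≠ ⊤ := hSb.measure_lt_top.ne
  obtain ⟨θ, hθ0, hA, hB⟩ := two_bounds d h1d hS hV hV0 (Real.exp (-(c * d))) (Real.exp_pos _)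
  set α := alphaS d S (Real.exp (-(c * d)))
  have hdpos : (0 : ℝ) < d := by exact_mod_cast h1d
  have hα0 : 0 ≤ α := le_trans (by positivity) hA
  rw [ge_iff_le, div_le_iff₀ (by positivity)]
  by_cases hε1 : 1 ≤ ε
  · refine le_trans ?_ (mul_nonneg hα0 (by positivity))
    have : (1 - ε) * L * d = -((ε - 1) * L * d) := by ring
    rw [this, neg_nonpos]
    have : 0 ≤ ε - 1 := by linarith
    positivity
  push Not at hε1
  have hδ : Real.exp (-(c * d)) * (2 * √3 ^ d) ≤ ε / 2 := by
    have h := (hd1 d hdd1).le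
    have e : Real.exp (-(c * d)) = Real.exp (-c) ^ d := by
      rw [← Real.exp_nat_mul]; congr 1; ring
    rw [e]
    rw [mul_pow] at h
    linarith
  rcases le_total ((1 - ε / 2) * L * d) θ with h | h
  · calc (1 - ε) * L * d ≤ (1 - ε / 2) * ((1 - ε / 2) * L * d) := by
          have : 0 < L * d := by positivity
          nlinarith [sq_nonneg ε]
      _ ≤ (1 - Real.exp (-(c * d)) * (2 * √3 ^ d)) * θ := by
          apply mul_le_mul (by linarith) h
          · have : 0 ≤ 1 - ε / 2 := by linarith
            positivity
          · linarith
      _ ≤ _ := by linarith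
  · have h2 : (2 : ℝ) ^ d = Real.exp (Real.log 2 * d) := by
      rw [mul_comm, Real.exp_nat_mul, Real.exp_log (by norm_num)]
    have hx0 : 0 ≤ ε / 2 * L * d := by positivity
    have hq := Real.quadratic_le_exp_of_nonneg hx0
    have h8 : 8 ≤ (d : ℝ) * (ε ^ 2 * L) := by
      have : 8 / (ε ^ 2 * L) ≤ (d : ℝ) := hd2.trans (by exact_mod_cast hdd2)
      rwa [div_le_iff₀ (by positivity)] at this
    calc (1 - ε) * L * d ≤ L * d := by
          have : 0 < L * d := by positivity
          nlinarith
      _ ≤ (ε / 2 * L * d) ^ 2 / 2 := by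
          have : 0 < L * d := by positivity
          nlinarith [mul_le_mul_of_nonneg_left h8 this.le]
      _ ≤ Real.exp (ε / 2 * L * d) := by linarith
      _ ≤ Real.exp (-(c * d)) * Real.exp (-θ) * 2 ^ d := by
          rw [h2, ← Real.exp_add, ← Real.exp_add, Real.exp_le_exp]
          have : Real.log 2 = L + c := by rw [hLdef]; ring
          rw [this]
          linarith
      _ ≤ α * 2 ^ d := by gcongr
end

section
/- Let d ≥ 1, let k ≥ 1 be an integer, and let 0 < n' ≤ n be reals. Then Ẑ_{B_n}(k) / n^k ≥ Ẑ_{B_{n'}}(k) / (n')^k. Equivalently, the probability that k independent uniformly random points of the ball of volume n centered at the origin have all pairwise distances strictly greater than 2 r_d is at least the corresponding probability for the ball of volume n'. -/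
open MeasureTheory Filter

open scoped Pointwise
/-- the probability that `k` uniform points of `B_n` form a packing is
monotone decreasing in the density, i.e. `Ẑ_{B_n}(k)/n^k ≥ Ẑ_{B_{n'}}(k)/(n')^k` for
`0 < n' ≤ n`. -/
theorem packing_probability_monotone (d : ℕ) (hd : 1 ≤ d) (k : ℕ) (hk : 1 ≤ k)
    (n n' : ℝ) (hn' : 0 < n') (hnn : n' ≤ n) :
    Zhat d (Bn d n) k / n ^ k ≥ Zhat d (Bn d n') k / n' ^ k := by
  have hn : 0 < n := hn'.trans_le hnn
  have hd0 : (d : ℝ) ≠ 0 := by positivity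
  -- the integral is the volume of the packing set
  have hZ : ∀ m : ℝ, Zhat d (Bn d m) k =
      (1 / (Nat.factorial k : ℝ)) * (volume (packSet d k (Bn d m))).toReal := by
    intro m
    have hm : MeasurableSet (packSet d k (Bn d m)) := by
      have h1 : packSet d k (Bn d m) =
          (⋂ i, {x : Fin k → EuclideanSpace ℝ (Fin d) | x i ∈ Bn d m}) ∩
          ⋂ i, ⋂ j, ⋂ (_ : i ≠ j), {x | 2 * rd d < dist (x i) (x j)} := by
        ext x
        simp [packSet]
      rw [h1]
      refine MeasurableSet.inter (MeasurableSet.iInter fun i => ?_)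
        (MeasurableSet.iInter fun i => MeasurableSet.iInter fun j =>
          MeasurableSet.iInter fun _ => ?_)
      · exact (Metric.isClosed_closedBall.preimage (continuous_apply i)).measurableSet
      · exact (isOpen_lt continuous_const (by fun_prop)).measurableSet
    unfold Zhat
    rw [integral_indicator hm]
    simp [Measure.real]
  have hfin : volume (packSet d k (Bn d n)) ≠ ⊤ := by
    have hb : Bornology.IsBounded
        (Set.pi Set.univ fun _ : Fin k => Bn d n) :=
      Bornology.IsBounded.pi fun _ => Metric.isBounded_closedBall
    refine ne_top_of_le_ne_top hb.measure_lt_top.ne (measure_mono ?_)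
    intro x hx i _
    exact hx.1 i
  set s : ℝ := (n / n') ^ ((1 : ℝ) / d) with hs
  have hq : 1 ≤ n / n' := (one_le_div hn').2 hnn
  have hs1 : 1 ≤ s := Real.one_le_rpow hq (by positivity)
  have hs0 : 0 < s := by linarith
  have hsd : s ^ d = n / n' := by
    rw [hs, ← Real.rpow_natCast, ← Real.rpow_mul (by positivity), one_div,
      inv_mul_cancel₀ hd0, Real.rpow_one]
  have hsn : s * n' ^ ((1 : ℝ) / d) = n ^ ((1 : ℝ) / d) := by
    rw [hs, ← Real.mul_rpow (by positivity) hn'.le, div_mul_cancel₀ _ hn'.ne']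
  have hsub : s • packSet d k (Bn d n') ⊆ packSet d k (Bn d n) := by
    rintro _ ⟨x, ⟨hx1, hx2⟩, rfl⟩
    refine ⟨fun i => ?_, fun i j hij => ?_⟩
    · have h := hx1 i
      simp only [Bn, mem_closedBall_zero_iff, Pi.smul_apply] at h ⊢
      rw [norm_smul, Real.norm_of_nonneg hs0.le, ← hsn, mul_assoc]
      exact mul_le_mul_of_nonneg_left h hs0.le
    · have h := hx2 i j hij
      simp only [Pi.smul_apply]
      rw [dist_smul₀, Real.norm_of_nonneg hs0.le]
      have h0 : 0 ≤ dist (x i) (x j) := dist_nonneg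
      nlinarith
  have hvol : (n / n') ^ k * (volume (packSet d k (Bn d n'))).toReal ≤
      (volume (packSet d k (Bn d n))).toReal := by
    have h := ENNReal.toReal_mono hfin (measure_mono hsub)
    rw [Measure.addHaar_smul, ENNReal.toReal_mul, ENNReal.toReal_ofReal (abs_nonneg _),
      abs_of_nonneg (by positivity)] at h
    have hr : Module.finrank ℝ (Fin k → EuclideanSpace ℝ (Fin d)) = d * k := by
      rw [Module.finrank_pi_fintype]
      simp [mul_comm]
    rwa [hr, pow_mul, hsd] at h
  rw [hZ, hZ, ge_iff_le, div_le_div_iff₀ (by positivity) (by positivity)]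
  rw [div_pow, div_mul_eq_mul_div, div_le_iff₀ (by positivity)] at hvol
  have hf : (0 : ℝ) ≤ 1 / (Nat.factorial k : ℝ) := by positivity
  have := mul_le_mul_of_nonneg_left hvol hf
  linarith
end
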